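/- arXiv:2005.11578 — 3 statements merged into one kernel-verified Lean document; each statement's English description precedes it below -/
import Mathlib

section
/- Let X be a Polish metric space and f : X → X uniformly continuous. Fix α > 0, ε > 0, s ∈ ℕ. For a Borel probability measure μ and x ∈ X define γ̲_μ^ε(x,s) = inf_{n ≥ s} (−log g_{x,ε,n}(μ))/n, where g_{x,ε,n}(μ) is the integral against μ of the piecewise-linear bump function of the Bowen metric d_n(x,·) at levels ε, 2ε. Then the set M(α,ε,s) = {μ ∈ P(X) : γ̲_μ^ε(x,s) ≤ α for μ-a.e. x} is a G_δ subset of P(X) with the weak topology. -/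
open Metric

/-- The Bowen metric of order `n`: `d_n(x,y) = max{d(f^i x, f^i y) : 0 ≤ i < n}`. -/
noncomputable def bowenDist {X : Type*} [PseudoMetricSpace X] (f : X → X) (n : ℕ) (x y : X) : ℝ :=
  (((Finset.range n).sup fun i => nndist (f^[i] x) (f^[i] y) : NNReal) : ℝ)

/-- The open Bowen ball of size `n` and radius `ε` centered at `x`. -/
def bowenBall {X : Type*} [PseudoMetricSpace X] (f : X → X) (n : ℕ) (x : X) (ε : ℝ) : Set X :=
  {y | bowenDist f n x y < ε}

/-- The piecewise-linear bump function of `d_n(x,·)` at levels `ε, 2ε`: equal to `1` when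
`d_n(x,y) ≤ ε`, to `2 − d_n(x,y)/ε` when `ε ≤ d_n(x,y) ≤ 2ε`, and to `0` when
`d_n(x,y) ≥ 2ε`. -/
noncomputable def bowenBump {X : Type*} [PseudoMetricSpace X] (f : X → X) (n : ℕ) (ε : ℝ)
    (x y : X) : ℝ :=
  max 0 (min 1 (2 - bowenDist f n x y / ε))

open MeasureTheory Filter
open scoped ENNReal

/-- `γ̲_μ^ε(x,s) = inf_{n ≥ s} (−log g_{x,ε,n}(μ))/n`, where `g_{x,ε,n}(μ)` is the integral
against `μ` of the bump function of the Bowen metric `d_n(x,·)` at levels `ε, 2ε`. -/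
noncomputable def gammaLower {X : Type*} [MetricSpace X] [MeasurableSpace X]
    (f : X → X) (μ : Measure X) (ε : ℝ) (x : X) (s : ℕ) : ℝ≥0∞ :=
  ⨅ (n : ℕ) (_ : s ≤ n),
    ENNReal.ofReal (-(Real.log (∫ y, bowenBump f n ε x y ∂μ)) / n)

section Helpers

open Topology

variable {X : Type*} [MetricSpace X]

lemma bowenDist_tri (f : X → X) (n : ℕ) (x y z : X) :
    bowenDist f n x z ≤ bowenDist f n x y + bowenDist f n y z := by
  unfold bowenDist
  rw [← NNReal.coe_add, NNReal.coe_le_coe]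
  refine Finset.sup_le fun i hi => (nndist_triangle _ (f^[i] y) _).trans (add_le_add ?_ ?_)
  · exact Finset.le_sup (f := fun i => nndist (f^[i] x) (f^[i] y)) hi
  · exact Finset.le_sup (f := fun i => nndist (f^[i] y) (f^[i] z)) hi

lemma bowenDist_symm (f : X → X) (n : ℕ) (x y : X) :
    bowenDist f n x y = bowenDist f n y x := by
  unfold bowenDist
  simp only [nndist_comm]

lemma bowenDist_self0 (f : X → X) (n : ℕ) (x : X) : bowenDist f n x x = 0 := by
  unfold bowenDist
  simp

lemma bowenDist_cont {f : X → X} (hf : Continuous f) (n : ℕ) (x : X) :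
    Continuous (fun y => bowenDist f n x y) := by
  unfold bowenDist
  refine NNReal.continuous_coe.comp (Continuous.finset_sup_apply fun i _ => ?_)
  exact continuous_const.nndist (hf.iterate i)

lemma bowenBump_cont {f : X → X} (hf : Continuous f) (n : ℕ) (ε : ℝ) (x : X) :
    Continuous (fun y => bowenBump f n ε x y) := by
  unfold bowenBump
  exact continuous_const.max (continuous_const.min
    (continuous_const.sub ((bowenDist_cont hf n x).div_const ε)))

lemma bowenBump_nonneg (f : X → X) (n : ℕ) (ε : ℝ) (x y : X) : 0 ≤ bowenBump f n ε x y :=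
  le_max_left _ _

lemma bowenBump_le_one (f : X → X) (n : ℕ) (ε : ℝ) (x y : X) : bowenBump f n ε x y ≤ 1 :=
  max_le zero_le_one (min_le_left _ _)

lemma bowenBump_le (f : X → X) (n : ℕ) {ε : ℝ} (hε : 0 < ε) (x z y : X) :
    bowenBump f n ε x y ≤ bowenBump f n ε z y + bowenDist f n x z / ε := by
  have h0 : 0 ≤ bowenDist f n x z / ε := div_nonneg (NNReal.coe_nonneg _) hε.le
  have h1 : bowenDist f n z y / ε ≤ bowenDist f n x z / ε + bowenDist f n x y / ε := by
    rw [← add_div]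
    have := bowenDist_tri f n z x y
    rw [bowenDist_symm f n z x] at this
    gcongr
  unfold bowenBump
  rcases le_total 1 (2 - bowenDist f n x y / ε) with h | h <;>
  rcases le_total 1 (2 - bowenDist f n z y / ε) with h' | h' <;>
  simp only [min_eq_left h, min_eq_right h, min_eq_left h', min_eq_right h'] <;>
  refine max_le (add_nonneg (le_max_left _ _) h0) ?_
  · have := le_max_right (0:ℝ) 1; linarith
  · have := le_max_right (0:ℝ) (2 - bowenDist f n z y / ε); linarith
  · have := le_max_right (0:ℝ) 1; linarith
  · have := le_max_right (0:ℝ) (2 - bowenDist f n z y / ε); linarith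

/-- The bump as a bounded continuous function. -/
noncomputable def bumpBCF {f : X → X} (hf : Continuous f) (n : ℕ) (ε : ℝ) (x : X) :
    BoundedContinuousFunction X ℝ :=
  BoundedContinuousFunction.ofNormedAddCommGroup (fun y => bowenBump f n ε x y)
    (bowenBump_cont hf n ε x) 1 (fun y => by
      rw [Real.norm_of_nonneg (bowenBump_nonneg f n ε x y)]
      exact bowenBump_le_one f n ε x y)

variable [MeasurableSpace X] [BorelSpace X]

lemma bowenBump_int {f : X → X} (hf : Continuous f) (n : ℕ) (ε : ℝ) (x : X)
    (μ : Measure X) [IsProbabilityMeasure μ] :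
    Integrable (fun y => bowenBump f n ε x y) μ :=
  (bumpBCF hf n ε x).integrable μ

lemma G_le {f : X → X} (hf : Continuous f) (n : ℕ) {ε : ℝ} (hε : 0 < ε) (x z : X)
    (μ : Measure X) [IsProbabilityMeasure μ] :
    ∫ y, bowenBump f n ε x y ∂μ ≤ ∫ y, bowenBump f n ε z y ∂μ + bowenDist f n x z / ε := by
  have h : ∫ y, (bowenBump f n ε z y + bowenDist f n x z / ε) ∂μ =
      ∫ y, bowenBump f n ε z y ∂μ + bowenDist f n x z / ε := by
    rw [integral_add (bowenBump_int hf n ε z μ) (integrable_const _)]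
    simp
  rw [← h]
  exact integral_mono (bowenBump_int hf n ε x μ)
    ((bowenBump_int hf n ε z μ).add (integrable_const _)) (fun y => bowenBump_le f n hε x z y)

lemma G_open {f : X → X} (hf : Continuous f) (n : ℕ) {ε : ℝ} (hε : 0 < ε) (c : ℝ) :
    IsOpen {p : ProbabilityMeasure X × X | c < ∫ y, bowenBump f n ε p.2 y ∂(p.1 : Measure X)} := by
  rw [isOpen_iff_mem_nhds]
  rintro ⟨μ, x⟩ h
  have h1 : Tendsto (fun p : ProbabilityMeasure X × X =>
      ∫ y, bowenBump f n ε x y ∂(p.1 : Measure X)) (𝓝 (μ, x))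
      (𝓝 (∫ y, bowenBump f n ε x y ∂(μ : Measure X))) :=
    (ProbabilityMeasure.tendsto_iff_forall_integral_tendsto.1
      (continuous_fst.tendsto (μ, x))) (bumpBCF hf n ε x)
  have h2 : Tendsto (fun p : ProbabilityMeasure X × X => bowenDist f n x p.2 / ε) (𝓝 (μ, x))
      (𝓝 0) := by
    have := (((bowenDist_cont hf n x).comp
      (continuous_snd (X := ProbabilityMeasure X))).div_const ε).tendsto (μ, x)
    simpa [bowenDist_self0] using this
  have h3 := h1.sub h2
  rw [sub_zero] at h3
  filter_upwards [h3.eventually (lt_mem_nhds h)] with p hp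
  have := G_le hf n hε x p.2 (p.1 : Measure X)
  change c < ∫ y, bowenBump f n ε p.2 y ∂(p.1 : Measure X)
  linarith

lemma G_pos {f : X → X} (hf : Continuous f) (n : ℕ) {ε : ℝ} (hε : 0 < ε) (x : X)
    (μ : Measure X) [IsProbabilityMeasure μ] (hx : x ∈ μ.support) :
    0 < ∫ y, bowenBump f n ε x y ∂μ := by
  rw [integral_pos_iff_support_of_nonneg (fun y => bowenBump_nonneg f n ε x y)
    (bowenBump_int hf n ε x μ)]
  refine (Measure.mem_support_iff_forall x).1 hx _ ?_
  refine (bowenBump_cont hf n ε x).isOpen_support.mem_nhds ?_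
  simp [Function.mem_support, bowenBump, bowenDist_self0]

lemma slice_open [PolishSpace X] (U : Set (ProbabilityMeasure X × X)) (hU : IsOpen U) (c : ℝ≥0∞) :
    IsOpen {μ : ProbabilityMeasure X | c < (μ : Measure X) {x | (μ, x) ∈ U}} := by
  rw [isOpen_iff_mem_nhds]
  intro μ hμ
  have hm : IsOpen {x | (μ, x) ∈ U} := hU.preimage (by fun_prop)
  obtain ⟨K, hKU, hK, hcK⟩ := hm.measurableSet.exists_lt_isCompact hμ
  obtain ⟨V, W, hV, hW, hμV, hKW, hVW⟩ := generalized_tube_lemma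
    (isCompact_singleton (x := μ)) hK hU (by
      rintro ⟨a, b⟩ ⟨ha, hb⟩
      obtain rfl : a = μ := ha
      exact hKU hb)
  have h1 := ProbabilityMeasure.le_liminf_measure_open_of_tendsto
    (tendsto_id (x := 𝓝 μ)) hW
  have h2 := eventually_lt_of_lt_liminf ((hcK.trans_le (measure_mono hKW)).trans_le h1)
  filter_upwards [h2, hV.mem_nhds (hμV rfl)] with ν hν hνV
  exact lt_of_lt_of_le hν (measure_mono fun x hx => hVW ⟨hνV, hx⟩)

lemma full_Gδ [PolishSpace X] (U : Set (ProbabilityMeasure X × X)) (hU : IsOpen U) :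
    IsGδ {μ : ProbabilityMeasure X | ∀ᵐ x ∂(μ : Measure X), (μ, x) ∈ U} := by
  have : {μ : ProbabilityMeasure X | ∀ᵐ x ∂(μ : Measure X), (μ, x) ∈ U} =
      ⋂ m : ℕ, {μ : ProbabilityMeasure X |
        1 - ((m : ℝ≥0∞) + 1)⁻¹ < (μ : Measure X) {x | (μ, x) ∈ U}} := by
    ext μ
    have hm : IsOpen {x | (μ, x) ∈ U} := hU.preimage (by fun_prop)
    have e : (∀ᵐ x ∂(μ : Measure X), (μ, x) ∈ U) ↔ (μ : Measure X) {x | (μ, x) ∈ U} = 1 :=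
      mem_ae_iff_prob_eq_one hm.measurableSet
    simp only [Set.mem_ofPred_eq, Set.mem_iInter]
    rw [e]
    constructor
    · intro h m
      rw [h]
      exact ENNReal.sub_lt_self ENNReal.one_ne_top one_ne_zero (by simp)
    · intro h
      refine le_antisymm prob_le_one ?_
      refine ENNReal.le_of_forall_pos_le_add fun δ hδ _ => ?_
      obtain ⟨m, hm⟩ := ENNReal.exists_inv_nat_lt (a := (δ : ℝ≥0∞)) (by simpa using hδ.ne')
      have h1 := (h m).le
      rw [tsub_le_iff_right] at h1
      refine h1.trans ?_
      gcongr
      refine le_trans ?_ hm.le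
      gcongr
      exact le_self_add
  rw [this]
  exact IsGδ.iInter fun m => (slice_open U hU _).isGδ

lemma gamma_iff (f : X → X) (α ε : ℝ) (hα : 0 < α) (s : ℕ) (hs : s ≠ 0) (μ : Measure X) (x : X)
    (hx : ∀ n, 0 < ∫ y, bowenBump f n ε x y ∂μ) :
    gammaLower f μ ε x s ≤ ENNReal.ofReal α ↔ ∀ k : ℕ, ∃ n, s ≤ n ∧
      Real.exp (-(n * (α + 1 / ((k : ℝ) + 1)))) < ∫ y, bowenBump f n ε x y ∂μ := by
  have key : ∀ (n : ℕ) (β : ℝ), 0 < β → s ≤ n →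
      (ENNReal.ofReal (-(Real.log (∫ y, bowenBump f n ε x y ∂μ)) / n) < ENNReal.ofReal β ↔
      Real.exp (-(n * β)) < ∫ y, bowenBump f n ε x y ∂μ) := by
    intro n β hβ hn
    have hn' : (0 : ℝ) < n := by exact_mod_cast (by omega : 0 < n)
    rw [ENNReal.ofReal_lt_ofReal_iff hβ, div_lt_iff₀ hn', ← Real.lt_log_iff_exp_lt (hx n)]
    constructor <;> intro h <;> linarith
  constructor
  · intro h k
    have hk : (0 : ℝ) < 1 / ((k : ℝ) + 1) := by positivity
    have hlt : gammaLower f μ ε x s < ENNReal.ofReal (α + 1 / ((k : ℝ) + 1)) :=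
      h.trans_lt ((ENNReal.ofReal_lt_ofReal_iff (by positivity)).2 (by linarith))
    unfold gammaLower at hlt
    simp only [iInf_lt_iff] at hlt
    obtain ⟨n, hn, h⟩ := hlt
    exact ⟨n, hn, (key n _ (by positivity) hn).1 h⟩
  · intro h
    refine ENNReal.le_of_forall_pos_le_add fun δ hδ _ => ?_
    obtain ⟨k, hk⟩ := exists_nat_one_div_lt (show (0 : ℝ) < δ from hδ)
    obtain ⟨n, hn, h⟩ := h k
    have h1 := ((key n _ (by positivity) hn).2 h).le
    refine (iInf₂_le n hn).trans (h1.trans ?_)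
    rw [ENNReal.ofReal_add hα.le (by positivity)]
    gcongr
    exact ENNReal.ofReal_le_of_le_toReal hk.le

end Helpers

theorem stmt10 {X : Type*} [MetricSpace X] [PolishSpace X] [MeasurableSpace X] [BorelSpace X]
    (f : X → X) (hf : UniformContinuous f) (α ε : ℝ) (hα : 0 < α) (hε : 0 < ε) (s : ℕ) :
    IsGδ {μ : ProbabilityMeasure X |
      ∀ᵐ x ∂(μ : Measure X), gammaLower f (μ : Measure X) ε x s ≤ ENNReal.ofReal α} := by
  have hc := hf.continuous
  rcases eq_or_ne s 0 with rfl | hs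
  · convert IsGδ.univ
    rw [Set.eq_univ_iff_forall]
    intro μ
    rw [Set.mem_ofPred_eq]
    refine Eventually.of_forall fun x => ?_
    unfold gammaLower
    refine (iInf₂_le 0 le_rfl).trans ?_
    simp
  let U : ℕ → Set (ProbabilityMeasure X × X) := fun k =>
    ⋃ n : ℕ, ⋃ _ : s ≤ n, {p | Real.exp (-(n * (α + 1 / ((k : ℝ) + 1)))) <
      ∫ y, bowenBump f n ε p.2 y ∂(p.1 : Measure X)}
  have hU : ∀ k, IsOpen (U k) := fun k =>
    isOpen_iUnion fun n => isOpen_iUnion fun _ => G_open hc n hε _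
  have : {μ : ProbabilityMeasure X |
      ∀ᵐ x ∂(μ : Measure X), gammaLower f (μ : Measure X) ε x s ≤ ENNReal.ofReal α} =
      ⋂ k, {μ : ProbabilityMeasure X | ∀ᵐ x ∂(μ : Measure X), (μ, x) ∈ U k} := by
    ext μ
    simp only [Set.mem_ofPred_eq, Set.mem_iInter]
    rw [← ae_all_iff]
    refine eventually_congr ?_
    filter_upwards [Measure.support_mem_ae (μ := (μ : Measure X))] with x hx
    rw [gamma_iff f α ε hα s hs _ x fun n => G_pos hc n hε x _ hx]
    simp [U]
  rw [this]
  exact IsGδ.iInter fun k => full_Gδ _ (hU k)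
end

section
/- Let X be a Polish metric space and f : X → X uniformly continuous. Then for every α ∈ (0,∞), the set E(α) = {μ ∈ M_e(f) : h_μ(f) ≤ α} of ergodic f-invariant measures with metric entropy at most α is a G_δ subset of M_e(f) (with the topology induced from the weak topology on probability measures). -/
open Metric

open MeasureTheory Filter
open scoped ENNReal

/-- The (Shannon) entropy `H(P) = −∑ μ(Pᵢ) log μ(Pᵢ)` of a countable family of sets. -/
noncomputable def partitionEntropy {X : Type*} [MeasurableSpace X] {ι : Type*} [Countable ι]
    (μ : MeasureTheory.Measure X) (P : ι → Set X) : ℝ≥0∞ :=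
  ∑' i, ENNReal.ofReal (Real.negMulLog ((μ (P i)).toReal))

/-- The dynamical refinement `P ∨ f⁻¹P ∨ ⋯ ∨ f^{-(n-1)}P` of a countable partition. -/
def dynRefine {X : Type*} (f : X → X) (P : ℕ → Set X) (n : ℕ) : (Fin n → ℕ) → Set X :=
  fun a => ⋂ i : Fin n, f^[i] ⁻¹' P (a i)

/-- `P` is a countable measurable partition of `X`. -/
def IsMeasPartition {X : Type*} [MeasurableSpace X] (P : ℕ → Set X) : Prop :=
  (∀ i, MeasurableSet (P i)) ∧ Pairwise (Function.onFun Disjoint P) ∧ (⋃ i, P i) = Set.univ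

/-- The Kolmogorov–Sinai metric entropy of `μ`:
`h_μ(f) = sup { lim_n H(Pₙ)/n : P countable measurable partition, H(P) < ∞ }`. -/
noncomputable def metricEntropy {X : Type*} [MeasurableSpace X]
    (μ : MeasureTheory.Measure X) (f : X → X) : ℝ≥0∞ :=
  ⨆ (P : ℕ → Set X) (_ : IsMeasPartition P ∧ partitionEntropy μ P < ⊤),
    Filter.liminf
      (fun n : ℕ => partitionEntropy μ (dynRefine f P n) / (n : ℝ≥0∞)) Filter.atTop

namespace EntGd

open Real

set_option linter.unusedSectionVars false

variable {Y ι κ κ' : Type*} [MeasurableSpace Y]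
  [MeasurableSpace ι] [MeasurableSingletonClass ι] [Countable ι]
  [MeasurableSpace κ] [MeasurableSingletonClass κ] [Countable κ]
  [MeasurableSpace κ'] [MeasurableSingletonClass κ'] [Countable κ']

/-- Entropy of a discrete random variable. -/
noncomputable def Hent (m : Measure Y) (ξ : Y → ι) : ℝ≥0∞ :=
  ∑' i, ENNReal.ofReal (Real.negMulLog ((m (ξ ⁻¹' {i})).toReal))

/-- Conditional entropy of `ξ` given `ζ`. -/
noncomputable def Hcond (m : Measure Y) (ξ : Y → ι) (ζ : Y → κ) : ℝ≥0∞ :=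
  ∑' i, ∑' j, ENNReal.ofReal ((m (ξ ⁻¹' {i} ∩ ζ ⁻¹' {j})).toReal *
    (Real.log (m (ζ ⁻¹' {j})).toReal - Real.log (m (ξ ⁻¹' {i} ∩ ζ ⁻¹' {j})).toReal))

lemma tsum_fiber (m : Measure Y) {ζ : Y → κ} (hζ : Measurable ζ) {A : Set Y} (_hA : MeasurableSet A)
    (g : κ → κ') (k : κ') :
    ∑' j : g ⁻¹' {k}, m (A ∩ ζ ⁻¹' {(j : κ)}) = m (A ∩ (g ∘ ζ) ⁻¹' {k}) := by
  have := tsum_measure_preimage_singleton (μ := m.restrict A) (f := ζ)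
    (s := g ⁻¹' {k}) (Set.to_countable _) (fun y _ => hζ (measurableSet_singleton y))
  rw [Measure.restrict_apply (hζ (Set.to_countable _).measurableSet)] at this
  rw [Set.inter_comm, Set.preimage_comp, ← this]
  refine tsum_congr fun j => ?_
  rw [Measure.restrict_apply (hζ (measurableSet_singleton _)), Set.inter_comm]

lemma tsum_all (m : Measure Y) {ζ : Y → κ} (hζ : Measurable ζ) {A : Set Y} (_hA : MeasurableSet A) :
    ∑' j : κ, m (A ∩ ζ ⁻¹' {j}) = m A := by
  have := tsum_measure_preimage_singleton (μ := m.restrict A) (f := ζ)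
    (s := Set.univ) (Set.to_countable _) (fun y _ => hζ (measurableSet_singleton y))
  rw [tsum_univ (fun j => (m.restrict A) (ζ ⁻¹' {j}))] at this
  simp only [Set.preimage_univ, Measure.restrict_apply MeasurableSet.univ, Set.univ_inter] at this
  rw [← this]
  refine tsum_congr fun j => ?_
  rw [Measure.restrict_apply (hζ (measurableSet_singleton _)), Set.inter_comm]

/-- Chain rule. -/
lemma Hent_prod (m : Measure Y) [IsProbabilityMeasure m] {ξ : Y → ι} {ζ : Y → κ}
    (hξ : Measurable ξ) (hζ : Measurable ζ) :
    Hent m (fun y => (ξ y, ζ y)) = Hent m ζ + Hcond m ξ ζ := by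
  unfold Hent Hcond
  have h0 := ENNReal.tsum_prod (f := fun (i : ι) (j : κ) =>
    ENNReal.ofReal (negMulLog ((m ((fun y => (ξ y, ζ y)) ⁻¹' {(i, j)})).toReal)))
  refine h0.trans ?_
  rw [ENNReal.tsum_comm, ENNReal.tsum_comm (α := ι), ← ENNReal.tsum_add]
  refine tsum_congr fun j => ?_
  have hpre : ∀ i, (fun y => (ξ y, ζ y)) ⁻¹' {(i, j)} = ξ ⁻¹' {i} ∩ ζ ⁻¹' {j} := by
    intro i; ext y; simp [Prod.ext_iff]
  simp_rw [hpre]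
  set q := m (ζ ⁻¹' {j}) with hq
  have hq1 : q.toReal ≤ 1 := by
    simpa using ENNReal.toReal_mono ENNReal.one_ne_top (prob_le_one (μ := m) (s := ζ ⁻¹' {j}))
  have hsum : ∑' i, m (ξ ⁻¹' {i} ∩ ζ ⁻¹' {j}) = q := by
    have := tsum_all m hξ (hζ (measurableSet_singleton j))
    simp_rw [Set.inter_comm (ζ ⁻¹' {j})] at this
    exact this
  have h1 : ENNReal.ofReal (negMulLog q.toReal) =
      ∑' i, m (ξ ⁻¹' {i} ∩ ζ ⁻¹' {j}) * ENNReal.ofReal (- log q.toReal) := by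
    rw [ENNReal.tsum_mul_right, hsum, negMulLog]
    have hqt : q ≠ ⊤ := measure_ne_top m _
    conv_rhs => rw [← ENNReal.ofReal_toReal hqt]
    rw [ENNReal.toReal_ofReal ENNReal.toReal_nonneg, ← ENNReal.ofReal_mul ENNReal.toReal_nonneg]
    congr 1; ring
  rw [h1, ← ENNReal.tsum_add]
  refine tsum_congr fun i => ?_
  set p := m (ξ ⁻¹' {i} ∩ ζ ⁻¹' {j}) with hp
  have hpq : p.toReal ≤ q.toReal :=
    ENNReal.toReal_mono (measure_ne_top m _) (measure_mono Set.inter_subset_right)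
  have hp0 : 0 ≤ p.toReal := ENNReal.toReal_nonneg
  have hpt : p ≠ ⊤ := measure_ne_top m _
  conv_rhs => rw [← ENNReal.ofReal_toReal hpt]
  rw [ENNReal.toReal_ofReal hp0, ← ENNReal.ofReal_mul ENNReal.toReal_nonneg, ← ENNReal.ofReal_add]
  · congr 1; rw [negMulLog]; ring
  · exact mul_nonneg hp0 (by have := log_nonpos ENNReal.toReal_nonneg hq1; linarith)
  · rcases hp0.eq_or_lt with h | h
    · simp [← h]
    · exact mul_nonneg hp0 (by have := log_le_log h hpq; linarith)

/-- Conditioning on more information decreases conditional entropy. -/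
lemma Hcond_le_comp (m : Measure Y) [IsProbabilityMeasure m] {ξ : Y → ι} {ζ : Y → κ}
    (hξ : Measurable ξ) (hζ : Measurable ζ) (g : κ → κ') :
    Hcond m ξ ζ ≤ Hcond m ξ (fun y => g (ζ y)) := by
  unfold Hcond
  refine ENNReal.tsum_le_tsum fun i => ?_
  rw [← ENNReal.tsum_fiberwise _ g]
  refine ENNReal.tsum_le_tsum fun k => ?_
  have hi : MeasurableSet (ξ ⁻¹' {i}) := hξ (measurableSet_singleton i)
  have s1 := tsum_fiber m hζ hi g k
  have s2 := tsum_fiber m hζ MeasurableSet.univ g k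
  simp only [Set.univ_inter] at s2
  change _ ≤ ENNReal.ofReal ((m (ξ ⁻¹' {i} ∩ (g ∘ ζ) ⁻¹' {k})).toReal *
    (log (m ((g ∘ ζ) ⁻¹' {k})).toReal - log (m (ξ ⁻¹' {i} ∩ (g ∘ ζ) ⁻¹' {k})).toReal))
  set A := ξ ⁻¹' {i} with hA
  set P := m (A ∩ (g ∘ ζ) ⁻¹' {k}) with hP
  set Q := m ((g ∘ ζ) ⁻¹' {k}) with hQ
  have hPt : P ≠ ⊤ := measure_ne_top m _
  have hQt : Q ≠ ⊤ := measure_ne_top m _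
  have hPQ : P.toReal ≤ Q.toReal :=
    ENNReal.toReal_mono hQt (measure_mono Set.inter_subset_right)
  rcases (ENNReal.toReal_nonneg (a := P)).eq_or_lt with hP0 | hP0
  · have hP0' : P = 0 := by
      rcases (ENNReal.toReal_eq_zero_iff P).1 hP0.symm with h | h
      · exact h
      · exact absurd h hPt
    rw [hP0', ENNReal.tsum_eq_zero] at s1
    simp [s1]
  have hQ0 : 0 < Q.toReal := hP0.trans_le hPQ
  have hlog : 0 ≤ log Q.toReal - log P.toReal := by
    have := log_le_log hP0 hPQ; linarith
  have key : ∀ j : g ⁻¹' {k}, ENNReal.ofReal ((m (A ∩ ζ ⁻¹' {(j : κ)})).toReal *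
      (log (m (ζ ⁻¹' {(j : κ)})).toReal - log (m (A ∩ ζ ⁻¹' {(j : κ)})).toReal))
      + m (A ∩ ζ ⁻¹' {(j : κ)}) ≤
      m (A ∩ ζ ⁻¹' {(j : κ)}) * ENNReal.ofReal (log Q.toReal - log P.toReal)
      + m (ζ ⁻¹' {(j : κ)}) * ENNReal.ofReal (P.toReal / Q.toReal) := by
    intro j
    set p := m (A ∩ ζ ⁻¹' {(j : κ)}) with hp
    set q := m (ζ ⁻¹' {(j : κ)}) with hq
    have hpt : p ≠ ⊤ := measure_ne_top m _
    have hqt : q ≠ ⊤ := measure_ne_top m _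
    have hpq : p.toReal ≤ q.toReal :=
      ENNReal.toReal_mono hqt (measure_mono Set.inter_subset_right)
    have e1 : p = ENNReal.ofReal p.toReal := (ENNReal.ofReal_toReal hpt).symm
    have e2 : q = ENNReal.ofReal q.toReal := (ENNReal.ofReal_toReal hqt).symm
    rcases (ENNReal.toReal_nonneg (a := p)).eq_or_lt with hp0 | hp0
    · have : p = 0 := by
        rcases (ENNReal.toReal_eq_zero_iff p).1 hp0.symm with h | h
        · exact h
        · exact absurd h hpt
      simp [this]
    have hq0 : 0 < q.toReal := hp0.trans_le hpq
    generalize p.toReal = a at *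
    generalize q.toReal = b at *
    rw [e1, e2, ← ENNReal.ofReal_mul hp0.le, ← ENNReal.ofReal_mul hq0.le, ← ENNReal.ofReal_add,
      ← ENNReal.ofReal_add]
    · apply ENNReal.ofReal_le_ofReal
      generalize P.toReal = c at *
      generalize Q.toReal = d at *
      have h := log_le_sub_one_of_pos (show 0 < (b * c) / (a * d) by positivity)
      rw [log_div (by positivity) (by positivity), log_mul (by positivity) (by positivity),
        log_mul (by positivity) (by positivity)] at h
      have h2 := mul_le_mul_of_nonneg_left h hp0.le
      have h3 : a * (b * c / (a * d) - 1) = b * (c / d) - a := by field_simp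
      rw [h3] at h2
      linarith
    · positivity
    · positivity
    · exact mul_nonneg hp0.le (by have := log_le_log hp0 hpq; linarith)
    · exact hp0.le
  have tot := ENNReal.tsum_le_tsum key
  rw [ENNReal.tsum_add, ENNReal.tsum_add, ENNReal.tsum_mul_right, ENNReal.tsum_mul_right, s1, s2]
    at tot
  have e3 : Q * ENNReal.ofReal (P.toReal / Q.toReal) = P := by
    conv_lhs => rw [← ENNReal.ofReal_toReal hQt]
    rw [ENNReal.toReal_ofReal hQ0.le, ← ENNReal.ofReal_mul hQ0.le, mul_div_cancel₀ _ hQ0.ne',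
      ENNReal.ofReal_toReal hPt]
  rw [e3] at tot
  have := (ENNReal.add_le_add_iff_right hPt).1 tot
  refine this.trans (le_of_eq ?_)
  conv_lhs => rw [← ENNReal.ofReal_toReal hPt]
  rw [ENNReal.toReal_ofReal hP0.le, ← ENNReal.ofReal_mul hP0.le]

lemma Hent_swap (m : Measure Y) (ξ : Y → ι) (ζ : Y → κ) :
    Hent m (fun y => (ξ y, ζ y)) = Hent m (fun y => (ζ y, ξ y)) := by
  unfold Hent
  rw [← (Equiv.prodComm κ ι).tsum_eq]
  refine tsum_congr fun p => ?_
  congr 4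
  ext y
  simp [Prod.ext_iff, and_comm]

lemma Hcond_self (m : Measure Y) (ζ : Y → κ) (g : κ → ι) :
    Hcond m (fun y => g (ζ y)) ζ = 0 := by
  unfold Hcond
  simp only [ENNReal.tsum_eq_zero]
  intro i j
  by_cases h : g j = i
  · have : (fun y => g (ζ y)) ⁻¹' {i} ∩ ζ ⁻¹' {j} = ζ ⁻¹' {j} := by
      ext y; simp; intro h'; rw [h', h]
    rw [this]; simp
  · have : (fun y => g (ζ y)) ⁻¹' {i} ∩ ζ ⁻¹' {j} = ∅ := by
      ext y; simp; intro h' h''; rw [h''] at h'; exact h h'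
    rw [this]; simp

lemma Hent_comp_le (m : Measure Y) [IsProbabilityMeasure m] {ζ : Y → κ} (hζ : Measurable ζ)
    (g : κ → ι) : Hent m (fun y => g (ζ y)) ≤ Hent m ζ := by
  have hg : Measurable (fun y => g (ζ y)) := (Measurable.of_discrete (f := g)).comp hζ
  calc Hent m (fun y => g (ζ y)) ≤ Hent m (fun y => g (ζ y)) + Hcond m ζ (fun y => g (ζ y)) :=
        le_self_add
    _ = Hent m (fun y => (ζ y, g (ζ y))) := (Hent_prod m hζ hg).symm
    _ = Hent m (fun y => (g (ζ y), ζ y)) := Hent_swap m _ _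
    _ = Hent m ζ + Hcond m (fun y => g (ζ y)) ζ := Hent_prod m hg hζ
    _ = Hent m ζ := by rw [Hcond_self, add_zero]

lemma Hcond_le_Hent (m : Measure Y) [IsProbabilityMeasure m] {ξ : Y → ι} {ζ : Y → κ}
    (hξ : Measurable ξ) (hζ : Measurable ζ) : Hcond m ξ ζ ≤ Hent m ξ := by
  refine (Hcond_le_comp m hξ hζ (fun _ => ())).trans (le_of_eq ?_)
  unfold Hcond Hent
  refine tsum_congr fun i => ?_
  rw [tsum_eq_single () (by simp)]
  simp [negMulLog]

lemma Hent_prod_le (m : Measure Y) [IsProbabilityMeasure m] {ξ : Y → ι} {ζ : Y → κ}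
    (hξ : Measurable ξ) (hζ : Measurable ζ) :
    Hent m (fun y => (ξ y, ζ y)) ≤ Hent m ξ + Hent m ζ := by
  rw [Hent_prod m hξ hζ, add_comm]
  gcongr
  exact Hcond_le_Hent m hξ hζ

lemma Hent_lt_top_of_fintype [Finite ι] (m : Measure Y) (ξ : Y → ι) : Hent m ξ < ⊤ := by
  have := Fintype.ofFinite ι
  unfold Hent
  rw [tsum_fintype]
  exact ENNReal.sum_lt_top.2 fun _ _ => ENNReal.ofReal_lt_top

lemma Hent_mp {Z : Type*} [MeasurableSpace Z] {m : Measure Y} {m' : Measure Z} {T : Z → Y}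
    (hT : MeasurePreserving T m' m) {ξ : Y → ι} (hξ : Measurable ξ) :
    Hent m' (fun z => ξ (T z)) = Hent m ξ := by
  unfold Hent
  refine tsum_congr fun i => ?_
  rw [← hT.measure_preimage (hξ (measurableSet_singleton i)).nullMeasurableSet]
  rfl

lemma Hcond_mp {Z : Type*} [MeasurableSpace Z] {m : Measure Y} {m' : Measure Z} {T : Z → Y}
    (hT : MeasurePreserving T m' m) {ξ : Y → ι} (hξ : Measurable ξ)
    {ζ : Y → κ} (hζ : Measurable ζ) :
    Hcond m' (fun z => ξ (T z)) (fun z => ζ (T z)) = Hcond m ξ ζ := by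
  unfold Hcond
  refine tsum_congr fun i => tsum_congr fun j => ?_
  rw [← hT.measure_preimage (hζ (measurableSet_singleton j)).nullMeasurableSet,
    ← hT.measure_preimage ((hξ (measurableSet_singleton i)).inter
      (hζ (measurableSet_singleton j))).nullMeasurableSet]
  rfl

lemma Hent_iter_le {ι : Type*} {κ : Type*}
    [MeasurableSpace ι] [MeasurableSingletonClass ι] [Countable ι]
    [MeasurableSpace κ] [MeasurableSingletonClass κ] [Countable κ]
    {m : Measure Y} [IsProbabilityMeasure m] {T : ℕ → Y → Y}
    (hT : ∀ n, MeasurePreserving (T n) m m) {ξ : Y → ι} (hξ : Measurable ξ)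
    {ζ : Y → κ} (hζ : Measurable ζ) (n : ℕ) :
    Hent m (fun y (i : Fin n) => ξ (T i y)) ≤
      Hent m (fun y (i : Fin n) => ζ (T i y)) + n * Hcond m ξ ζ := by
  have mξ : ∀ n, Measurable (fun y (i : Fin n) => ξ (T i y)) := fun n =>
    measurable_pi_lambda _ fun i => hξ.comp (hT i).measurable
  have mζ : ∀ n, Measurable (fun y (i : Fin n) => ζ (T i y)) := fun n =>
    measurable_pi_lambda _ fun i => hζ.comp (hT i).measurable
  suffices h : Hent m (fun y => ((fun i : Fin n => ξ (T i y)), (fun i : Fin n => ζ (T i y)))) ≤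
      Hent m (fun y (i : Fin n) => ζ (T i y)) + n * Hcond m ξ ζ from
    (Hent_comp_le m ((mξ n).prodMk (mζ n)) Prod.fst).trans h
  induction n with
  | zero =>
    simp only [Nat.cast_zero, zero_mul, add_zero]
    refine Hent_comp_le m (mζ 0) (fun a => ((fun i : Fin 0 => i.elim0 : Fin 0 → ι), a)) |>.trans' (le_of_eq ?_)
    congr 1; ext y : 1
    refine Prod.ext (Subsingleton.elim _ _) rfl
  | succ n ih =>
    have hξn : Measurable (fun y => ξ (T n y)) := hξ.comp (hT n).measurable
    have hζn : Measurable (fun y => ζ (T n y)) := hζ.comp (hT n).measurable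
    have A : Measurable (fun y => ((fun i : Fin n => ξ (T i y)), (fun i : Fin n => ζ (T i y)))) :=
      (mξ n).prodMk (mζ n)
    have B := hζn.prodMk A
    have C := hξn.prodMk B
    have h1 := Hent_comp_le m C
      (fun p => ((Fin.snoc p.2.2.1 p.1 : Fin (n + 1) → ι), (Fin.snoc p.2.2.2 p.2.1 : Fin (n+1) → κ)))
    have e1 : (fun y => ((fun i : Fin (n+1) => ξ (T i y)), (fun i : Fin (n+1) => ζ (T i y)))) =
      (fun y => ((Fin.snoc (fun i : Fin n => ξ (T i y)) (ξ (T n y)) : Fin (n + 1) → ι),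
        (Fin.snoc (fun i : Fin n => ζ (T i y)) (ζ (T n y)) : Fin (n+1) → κ))) := by
      ext y i
      · refine Fin.lastCases ?_ (fun j => ?_) i <;> simp
      · refine Fin.lastCases ?_ (fun j => ?_) i <;> simp
    rw [e1]
    refine h1.trans ?_
    rw [Hent_prod m hξn B, Hent_prod m hζn A]
    have c1 : Hcond m (fun y => ξ (T n y)) (fun y => (ζ (T n y),
        ((fun i : Fin n => ξ (T i y)), (fun i : Fin n => ζ (T i y))))) ≤ Hcond m ξ ζ := by
      refine (Hcond_le_comp m hξn B Prod.fst).trans (le_of_eq ?_)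
      exact Hcond_mp (hT n) hξ hζ
    have c2 : Hcond m (fun y => ζ (T n y)) (fun y =>
        ((fun i : Fin n => ξ (T i y)), (fun i : Fin n => ζ (T i y)))) ≤
        Hcond m (fun y => ζ (T n y)) (fun y => (fun i : Fin n => ζ (T i y))) :=
      Hcond_le_comp m hζn A Prod.snd
    have c3 : Hent m (fun y (i : Fin n) => ζ (T i y)) +
        Hcond m (fun y => ζ (T n y)) (fun y => (fun i : Fin n => ζ (T i y))) ≤
        Hent m (fun y (i : Fin (n+1)) => ζ (T i y)) := by
      rw [← Hent_prod m hζn (mζ n)]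
      exact Hent_comp_le m (mζ (n+1)) (fun a => (a (Fin.last n), fun i : Fin n => a i.castSucc))
    calc _ ≤ (Hent m (fun y (i : Fin n) => ζ (T i y)) + n * Hcond m ξ ζ) +
          Hcond m (fun y => ζ (T n y)) (fun y => (fun i : Fin n => ζ (T i y))) + Hcond m ξ ζ := by
          gcongr
      _ = (Hent m (fun y (i : Fin n) => ζ (T i y)) +
          Hcond m (fun y => ζ (T n y)) (fun y => (fun i : Fin n => ζ (T i y)))) +
          (n + 1) * Hcond m ξ ζ := by ring
      _ ≤ _ := by push_cast; gcongr

/-- Fano-type estimate. -/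
lemma Hcond_small (ι : Type*) [Finite ι] [MeasurableSpace ι] [MeasurableSingletonClass ι]
    {δ : ℝ} (hδ : 0 < δ) :
    ∃ ε : ℝ, 0 < ε ∧ ∀ {Y : Type*} [MeasurableSpace Y] (m : Measure Y) [IsProbabilityMeasure m]
      (ξ ζ : Y → ι), Measurable ξ → Measurable ζ → m {y | ξ y ≠ ζ y} ≤ ENNReal.ofReal ε →
      Hcond m ξ ζ ≤ ENNReal.ofReal δ := by
  have := Fintype.ofFinite ι
  set N : ℝ := (Fintype.card ι : ℝ) with hN
  set K : ℝ := δ / (N * N + 1) with hK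
  have hK0 : 0 < K := by positivity
  have hcont : Tendsto negMulLog (nhds 0) (nhds 0) := by
    simpa using continuous_negMulLog.tendsto 0
  obtain ⟨ε₀, hε₀, h₀⟩ := Metric.eventually_nhds_iff.1 (hcont.eventually (gt_mem_nhds hK0))
  refine ⟨min (ε₀ / 2) K, by positivity, ?_⟩
  intro Y _ m _ ξ ζ hξ hζ hm
  have he0 : (m {y | ξ y ≠ ζ y}).toReal ≤ min (ε₀ / 2) K :=
    ENNReal.toReal_le_of_le_ofReal (by positivity) hm
  have hterm : ∀ i j, ENNReal.ofReal ((m (ξ ⁻¹' {i} ∩ ζ ⁻¹' {j})).toReal *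
    (Real.log (m (ζ ⁻¹' {j})).toReal - Real.log (m (ξ ⁻¹' {i} ∩ ζ ⁻¹' {j})).toReal))
      ≤ ENNReal.ofReal K := by
    intro i j
    apply ENNReal.ofReal_le_ofReal
    have hpq : (m (ξ ⁻¹' {i} ∩ ζ ⁻¹' {j})).toReal ≤ (m (ζ ⁻¹' {j})).toReal :=
      ENNReal.toReal_mono (measure_ne_top m _) (measure_mono Set.inter_subset_right)
    have hq1 : (m (ζ ⁻¹' {j})).toReal ≤ 1 := by
      simpa using ENNReal.toReal_mono ENNReal.one_ne_top (prob_le_one (μ := m) (s := ζ ⁻¹' {j}))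
    rcases (ENNReal.toReal_nonneg (a := m (ξ ⁻¹' {i} ∩ ζ ⁻¹' {j}))).eq_or_lt with hp0 | hp0
    · rw [← hp0]; simpa using hK0.le
    by_cases hij : i = j
    · subst hij
      have hsub : m (ζ ⁻¹' {i}) ≤ m (ξ ⁻¹' {i} ∩ ζ ⁻¹' {i}) + m {y | ξ y ≠ ζ y} := by
        refine (measure_mono ?_).trans (measure_union_le _ _)
        intro y hy
        by_cases h : ξ y = ζ y
        · left; exact ⟨by simpa [h] using hy, hy⟩
        · right; exact h
      have hsub' : (m (ζ ⁻¹' {i})).toReal ≤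
          (m (ξ ⁻¹' {i} ∩ ζ ⁻¹' {i})).toReal + (m {y | ξ y ≠ ζ y}).toReal := by
        rw [← ENNReal.toReal_add (measure_ne_top m _) (measure_ne_top m _)]
        exact ENNReal.toReal_mono (by finiteness) hsub
      have hKe := he0.trans (min_le_right _ _)
      generalize (m (ξ ⁻¹' {i} ∩ ζ ⁻¹' {i})).toReal = a at *
      generalize (m (ζ ⁻¹' {i})).toReal = b at *
      have hb : 0 < b := hp0.trans_le hpq
      have h := log_le_sub_one_of_pos (show 0 < b / a by positivity)
      rw [log_div hb.ne' hp0.ne'] at h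
      have h2 := mul_le_mul_of_nonneg_left h hp0.le
      have h3 : a * (b / a - 1) = b - a := by field_simp
      rw [h3] at h2
      linarith
    · have hle : (m (ξ ⁻¹' {i} ∩ ζ ⁻¹' {j})).toReal ≤ (m {y | ξ y ≠ ζ y}).toReal := by
        refine ENNReal.toReal_mono (measure_ne_top m _) (measure_mono ?_)
        rintro y ⟨h1, h2⟩
        simp only [Set.mem_preimage, Set.mem_singleton_iff] at h1 h2
        simp only [Set.mem_ofPred_eq, h1, h2]
        exact hij
      have hle2 := (hle.trans he0).trans (min_le_left _ _)
      generalize (m (ξ ⁻¹' {i} ∩ ζ ⁻¹' {j})).toReal = a at *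
      generalize (m (ζ ⁻¹' {j})).toReal = b at *
      have hh := h₀ (y := a) (by
        rw [Real.dist_eq, sub_zero, abs_of_pos hp0]; linarith)
      have hlb := log_nonpos (hp0.le.trans hpq) hq1
      rw [negMulLog] at hh
      nlinarith
  unfold Hcond
  calc _ ≤ ∑' (_ : ι), ∑' (_ : ι), ENNReal.ofReal K :=
        ENNReal.tsum_le_tsum fun i => ENNReal.tsum_le_tsum fun j => hterm i j
    _ = ENNReal.ofReal (N * (N * K)) := by
        simp only [tsum_fintype, Finset.sum_const, Finset.card_univ, nsmul_eq_mul]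
        rw [ENNReal.ofReal_mul (by positivity), ENNReal.ofReal_mul (by positivity), hN,
          ENNReal.ofReal_natCast]
    _ ≤ ENNReal.ofReal δ := by
        apply ENNReal.ofReal_le_ofReal
        rw [hK, ← mul_assoc, mul_div_assoc', div_le_iff₀ (by positivity)]
        nlinarith

end EntGd

namespace EntGd

open Real

/-- Uniform measure on `[0,1]`. -/
noncomputable def lam : Measure ℝ := volume.restrict (Set.Icc 0 1)

instance : IsProbabilityMeasure lam := ⟨by simp [lam]⟩

lemma lam_le_of_subset {s : Set ℝ} {a b : ℝ}
    (h : ∀ t ∈ s, 0 ≤ t → t ≤ 1 → a ≤ t ∧ t ≤ b) : lam s ≤ ENNReal.ofReal (b - a) := by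
  rw [lam, Measure.restrict_apply' measurableSet_Icc, ← Real.volume_Icc]
  exact measure_mono fun t ht => h t ht.1 ht.2.1 ht.2.2

section
variable {X : Type*} [MeasurableSpace X]

/-- The under-graph code of finitely many functions. -/
noncomputable def zeta {M : ℕ} (φ : Fin M → X → ℝ) (y : X × ℝ) : Fin M → Bool :=
  fun i => decide (y.2 < φ i y.1)

lemma measurable_zeta {M : ℕ} {φ : Fin M → X → ℝ} (hφ : ∀ i, Measurable (φ i)) :
    Measurable (zeta φ) := by
  refine measurable_pi_lambda _ fun i => measurable_to_bool ?_
  have : (fun y : X × ℝ => zeta φ y i) ⁻¹' {true} = {y | y.2 < φ i y.1} := by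
    ext y; simp [zeta]
  rw [this]
  exact measurableSet_lt measurable_snd ((hφ i).comp measurable_fst)

/-- The entropy of the `n`-fold under-graph code. -/
noncomputable def GG (f : X → X) {M : ℕ} (φ : Fin M → X → ℝ) (n : ℕ) (μ : Measure X) : ℝ≥0∞ :=
  Hent (μ.prod lam) (fun y (k : Fin n) => zeta φ (f^[k] y.1, y.2))

lemma liminf_le_aux {a : ℕ → ℝ≥0∞} {B : ℝ≥0∞}
    (h : ∀ δ : NNReal, 0 < δ → ∃ (b : ℕ → ℝ≥0∞) (C : ℝ≥0∞), C < ⊤ ∧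
      liminf (fun n : ℕ => b n / (n : ℝ≥0∞)) atTop ≤ B ∧ ∀ n : ℕ, a n ≤ b n + C + n * δ) :
    liminf (fun n : ℕ => a n / (n : ℝ≥0∞)) atTop ≤ B := by
  refine ENNReal.le_of_forall_pos_le_add fun ε hε hB => ?_
  obtain ⟨b, C, hC, hb, hab⟩ := h (ε / 3) (by positivity)
  have hδ : (0 : ℝ≥0∞) < ((ε / 3 : NNReal) : ℝ≥0∞) := by
    exact_mod_cast (by positivity : 0 < ε / 3)
  have hlt : liminf (fun n : ℕ => b n / (n : ℝ≥0∞)) atTop < B + ((ε / 3 : NNReal) : ℝ≥0∞) :=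
    hb.trans_lt (ENNReal.lt_add_right hB.ne hδ.ne')
  have hfr := frequently_lt_of_liminf_lt (by isBoundedDefault) hlt
  have hev : ∀ᶠ n : ℕ in atTop, C / (n : ℝ≥0∞) < ((ε / 3 : NNReal) : ℝ≥0∞) := by
    have : Tendsto (fun n : ℕ => C / (n : ℝ≥0∞)) atTop (nhds 0) := by
      have := ENNReal.Tendsto.const_div (a := C) ENNReal.tendsto_nat_nhds_top (Or.inr hC.ne)
      simpa using this
    exact this.eventually (gt_mem_nhds hδ)
  refine liminf_le_of_frequently_le' ?_
  refine (hfr.and_eventually (hev.and (eventually_gt_atTop 0))).mono ?_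
  rintro n ⟨h1, h2, h3⟩
  have hn0 : (n : ℝ≥0∞) ≠ 0 := by exact_mod_cast h3.ne'
  calc a n / (n : ℝ≥0∞) ≤ (b n + C + n * ((ε / 3 : NNReal) : ℝ≥0∞)) / n := by gcongr; exact hab n
    _ = b n / n + C / n + ((ε / 3 : NNReal) : ℝ≥0∞) := by
        rw [ENNReal.add_div, ENNReal.add_div, mul_comm,
          ENNReal.mul_div_cancel_right hn0 (ENNReal.natCast_ne_top n)]
    _ ≤ (B + ((ε / 3 : NNReal) : ℝ≥0∞)) + ((ε / 3 : NNReal) : ℝ≥0∞) + ((ε / 3 : NNReal) : ℝ≥0∞) := by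
        gcongr
    _ = B + ε := by
        rw [add_assoc, add_assoc]
        congr 1
        norm_cast
        apply NNReal.eq; push_cast; ring

lemma mp_iter {f : X → X} {μ : Measure X} [IsProbabilityMeasure μ]
    (hf : MeasurePreserving f μ μ) (k : ℕ) :
    MeasurePreserving (fun y : X × ℝ => (f^[k] y.1, y.2)) (μ.prod lam) (μ.prod lam) :=
  (hf.iterate k).prod (MeasurePreserving.id lam)

lemma prod_ne_le {μ : Measure X} [IsProbabilityMeasure μ] {M : ℕ}
    {ξ ζ : X × ℝ → Fin M → Bool} (hξ : Measurable ξ) (hζ : Measurable ζ)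
    (u : Fin M → X → ℝ≥0∞)
    (h : ∀ i x, lam {t | ξ (x, t) i ≠ ζ (x, t) i} ≤ u i x) :
    (μ.prod lam) {y | ξ y ≠ ζ y} ≤ ∑ i, ∫⁻ x, u i x ∂μ := by
  have : {y | ξ y ≠ ζ y} = ⋃ i, {y | ξ y i ≠ ζ y i} := by
    ext y; simp [Function.ne_iff]
  rw [this]
  refine (measure_iUnion_fintype_le _ _).trans (Finset.sum_le_sum fun i _ => ?_)
  have hm : MeasurableSet {y | ξ y i ≠ ζ y i} :=
    (measurableSet_eq_fun ((measurable_pi_apply i).comp hξ)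
      ((measurable_pi_apply i).comp hζ)).compl
  rw [Measure.prod_apply hm]
  exact lintegral_mono fun x => h i x

lemma Hent_le_metricEntropy {ι : Type*} [MeasurableSpace ι] [MeasurableSingletonClass ι] [Finite ι]
    [Nonempty ι]
    {f : X → X} {μ : Measure X} [IsProbabilityMeasure μ] (hf : Measurable f)
    {R : X → ι} (hR : Measurable R) :
    liminf (fun n : ℕ => Hent μ (fun x (k : Fin n) => R (f^[k] x)) / (n : ℝ≥0∞)) atTop ≤
      metricEntropy μ f := by
  obtain ⟨e, he⟩ := exists_injective_nat ι
  have hL : Measurable (fun x => e (R x)) := (Measurable.of_discrete (f := e)).comp hR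
  unfold metricEntropy
  refine le_iSup₂_of_le (fun i => (fun x => e (R x)) ⁻¹' {i}) ⟨⟨?_, ?_, ?_⟩, ?_⟩ ?_
  · exact fun i => hL (measurableSet_singleton i)
  · intro i j hij
    exact Disjoint.preimage _ (by simpa using hij)
  · ext x; simp
  · exact (Hent_comp_le μ hR e).trans_lt (Hent_lt_top_of_fintype μ R)
  · refine liminf_le_liminf (Eventually.of_forall fun n => ?_)
    refine ENNReal.div_le_div_right ?_ _
    have mL : Measurable (fun x (k : Fin n) => e (R (f^[k] x))) :=
      measurable_pi_lambda _ fun k => hL.comp (hf.iterate k)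
    have h1 := Hent_comp_le μ mL (fun a k => Function.invFun e (a k))
    simp only [Function.leftInverse_invFun he _] at h1
    refine h1.trans (le_of_eq ?_)
    unfold Hent partitionEntropy
    refine tsum_congr fun a => ?_
    congr 4
    ext x
    simp [dynRefine, funext_iff]

/-- First direction. -/
lemma liminf_GG_le {f : X → X} {μ : Measure X} [IsProbabilityMeasure μ]
    (hf : MeasurePreserving f μ μ) {M : ℕ} {φ : Fin M → X → ℝ} (hφ : ∀ i, Measurable (φ i)) :
    liminf (fun n : ℕ => GG f φ n μ / (n : ℝ≥0∞)) atTop ≤ metricEntropy μ f := by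
  refine liminf_le_aux fun δ hδ => ?_
  obtain ⟨ε, hε, H⟩ := Hcond_small (Fin M → Bool) (δ := (δ : ℝ)) (by exact_mod_cast hδ)
  obtain ⟨q, hq⟩ := exists_nat_gt (M / ε)
  have hMε : 0 ≤ M / ε := by positivity
  have hq0 : (0 : ℝ) < q := hMε.trans_lt hq
  let Q : ℝ → Fin (q + 1) := fun t => ⟨min ⌊q * t⌋₊ q, by omega⟩
  let R : X → Fin (q + 1) → Fin M → Bool := fun x j i => decide ((j : ℕ) / (q : ℝ) < φ i x)
  have hQ : Measurable Q := by
    have h1 : Measurable (fun t : ℝ => ⌊q * t⌋₊) :=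
      Nat.measurable_floor.comp (measurable_const.mul measurable_id)
    exact (Measurable.of_discrete (f := fun k : ℕ => (⟨min k q, by omega⟩ : Fin (q + 1)))).comp h1
  have hR : Measurable R := by
    refine measurable_pi_lambda _ fun j => measurable_pi_lambda _ fun i => measurable_to_bool ?_
    have : (fun x => R x j i) ⁻¹' {true} = {x | (j : ℕ) / (q : ℝ) < φ i x} := by
      ext x; simp [R]
    rw [this]
    exact measurableSet_lt measurable_const (hφ i)
  have hRQ : Measurable (fun y : X × ℝ => (R y.1, Q y.2)) :=
    (hR.comp measurable_fst).prodMk (hQ.comp measurable_snd)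
  let ζ' : X × ℝ → Fin M → Bool := fun y => R y.1 (Q y.2)
  have hζ' : Measurable ζ' :=
    (Measurable.of_discrete (f := fun p : (Fin (q + 1) → Fin M → Bool) × Fin (q + 1) =>
      p.1 p.2)).comp hRQ
  have hne : (μ.prod lam) {y | zeta φ y ≠ ζ' y} ≤ ENNReal.ofReal ε := by
    refine (prod_ne_le (measurable_zeta hφ) hζ' (fun _ _ => ENNReal.ofReal (1 / q)) ?_).trans ?_
    · intro i x
      have := lam_le_of_subset (s := {t | zeta φ (x, t) i ≠ ζ' (x, t) i}) (a := φ i x)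
        (b := φ i x + 1 / q) ?_
      · simpa using this
      intro t ht ht0 ht1
      have hfl : ⌊q * t⌋₊ ≤ q := by
        refine Nat.floor_le_of_le ?_
        nlinarith
      have hQt : ((Q t : ℕ) : ℝ) = (⌊q * t⌋₊ : ℝ) := by simp [Q, hfl]
      have h1 := Nat.floor_le (show 0 ≤ q * t by positivity)
      have h2 := Nat.lt_floor_add_one (q * t)
      have h3 : ((Q t : ℕ) : ℝ) / q ≤ t := by rw [hQt, div_le_iff₀ hq0]; linarith
      have h4 : t ≤ ((Q t : ℕ) : ℝ) / q + 1 / q := by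
        rw [hQt, ← add_div, le_div_iff₀ hq0]; linarith
      have ht' : ¬ (t < φ i x ↔ ((Q t : ℕ) : ℝ) / q < φ i x) := by
        intro h
        apply ht
        simp only [zeta, ζ', R, h]
      by_cases h5 : t < φ i x
      · exact absurd ⟨fun _ => h3.trans_lt h5, fun _ => h5⟩ ht'
      · by_cases h6 : ((Q t : ℕ) : ℝ) / q < φ i x
        · exact ⟨not_lt.1 h5, by linarith⟩
        · exact absurd ⟨fun h => absurd h h5, fun h => absurd h h6⟩ ht'
    · simp only [lintegral_const, measure_univ, mul_one, Finset.sum_const, Finset.card_univ,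
        Fintype.card_fin, nsmul_eq_mul]
      rw [← ENNReal.ofReal_natCast, ← ENNReal.ofReal_mul (by positivity)]
      apply ENNReal.ofReal_le_ofReal
      rw [mul_one_div, div_le_iff₀ hq0]
      rw [div_lt_iff₀ hε] at hq
      linarith
  refine ⟨fun n => Hent μ (fun x (k : Fin n) => R (f^[k] x)),
    Hent (μ.prod lam) (fun y => Q y.2), Hent_lt_top_of_fintype _ _,
    Hent_le_metricEntropy hf.measurable hR, fun n => ?_⟩
  have h1 := Hent_iter_le (mp_iter hf) (measurable_zeta hφ) hζ' n
  have h2 := H (μ.prod lam) _ _ (measurable_zeta hφ) hζ' hne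
  rw [ENNReal.ofReal_coe_nnreal] at h2
  refine h1.trans ?_
  gcongr
  have mR : Measurable (fun x (k : Fin n) => R (f^[k] x)) :=
    measurable_pi_lambda _ fun k => hR.comp (hf.measurable.iterate k)
  have mR' : Measurable (fun (y : X × ℝ) (k : Fin n) => R (f^[k] y.1)) := mR.comp measurable_fst
  have mQ' : Measurable (fun (y : X × ℝ) => Q y.2) := hQ.comp measurable_snd
  beta_reduce
  rw [← Hent_mp (measurePreserving_fst (μ := μ) (ν := lam)) mR]
  refine le_trans ?_ (Hent_prod_le (μ.prod lam) mR' mQ')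
  exact Hent_comp_le (μ.prod lam) (mR'.prodMk mQ') (fun p k => p.1 k p.2)

lemma Hcond_tail {Y κ : Type*} [MeasurableSpace Y] [MeasurableSpace κ]
    (m : Measure Y) [IsProbabilityMeasure m] (L : Y → ℕ) (g : ℕ → κ) (M : ℕ)
    (hg : ∀ l l', l < M → g l' = g l → l' = l) :
    Hcond m L (fun y => g (L y)) ≤
      ∑' k, ENNReal.ofReal (negMulLog (m (L ⁻¹' {k + M})).toReal) := by
  unfold Hcond
  have hD : ∀ l, (∑' j, ENNReal.ofReal ((m (L ⁻¹' {l} ∩ (fun y => g (L y)) ⁻¹' {j})).toReal *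
    (log (m ((fun y => g (L y)) ⁻¹' {j})).toReal -
      log (m (L ⁻¹' {l} ∩ (fun y => g (L y)) ⁻¹' {j})).toReal))) =
      ENNReal.ofReal ((m (L ⁻¹' {l})).toReal *
    (log (m ((fun y => g (L y)) ⁻¹' {g l})).toReal - log (m (L ⁻¹' {l})).toReal)) := by
    intro l
    rw [tsum_eq_single (g l)]
    · have : L ⁻¹' {l} ∩ (fun y => g (L y)) ⁻¹' {g l} = L ⁻¹' {l} := by
        ext y; simp; intro h; rw [h]
      rw [this]
    · intro j hj
      have : L ⁻¹' {l} ∩ (fun y => g (L y)) ⁻¹' {j} = ∅ := by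
        ext y; simp; intro h; rw [h]; exact hj.symm
      rw [this]; simp
  simp_rw [hD]
  rw [← Summable.sum_add_tsum_nat_add' (k := M) ENNReal.summable]
  rw [Finset.sum_eq_zero, zero_add]
  · refine ENNReal.tsum_le_tsum fun k => ENNReal.ofReal_le_ofReal ?_
    have hq1 : (m ((fun y => g (L y)) ⁻¹' {g (k + M)})).toReal ≤ 1 := by
      simpa using ENNReal.toReal_mono ENNReal.one_ne_top
        (prob_le_one (μ := m) (s := (fun y => g (L y)) ⁻¹' {g (k + M)}))
    have h1 := log_nonpos ENNReal.toReal_nonneg hq1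
    have h2 : 0 ≤ (m (L ⁻¹' {k + M})).toReal := ENNReal.toReal_nonneg
    rw [negMulLog]
    nlinarith
  · intro l hl
    have : (fun y => g (L y)) ⁻¹' {g l} = L ⁻¹' {l} := by
      ext y
      simp only [Set.mem_preimage, Set.mem_singleton_iff]
      exact ⟨fun h => hg _ _ (Finset.mem_range.1 hl) h, fun h => by rw [h]⟩
    rw [this]; simp

/-- Second direction. -/
lemma metricEntropy_le {f : X → X} {μ : Measure X} [IsProbabilityMeasure μ]
    (hf : MeasurePreserving f μ μ) {C : Type*} {φ : C → X → ℝ} (hφ : ∀ c, Measurable (φ c))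
    (happ : ∀ A, MeasurableSet A → ∀ ε : ℝ, 0 < ε →
      ∃ c, ∫⁻ x, ENNReal.ofReal |φ c x - A.indicator (fun _ => (1 : ℝ)) x| ∂μ ≤ ENNReal.ofReal ε)
    {B : ℝ≥0∞}
    (hB : ∀ (M : ℕ) (c : Fin M → C),
      liminf (fun n : ℕ => GG f (fun i => φ (c i)) n μ / (n : ℝ≥0∞)) atTop ≤ B) :
    metricEntropy μ f ≤ B := by
  unfold metricEntropy
  refine iSup₂_le fun P hP => ?_
  obtain ⟨⟨hPm, hPd, hPu⟩, hPe⟩ := hP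
  have hex : ∀ x, ∃ i, x ∈ P i := fun x => by
    have : x ∈ ⋃ i, P i := by rw [hPu]; trivial
    simpa using this
  choose L hLmem using hex
  have hLi : ∀ x i, L x = i ↔ x ∈ P i := by
    intro x i
    constructor
    · rintro rfl; exact hLmem x
    · intro h
      by_contra hne
      exact Set.disjoint_left.1 (hPd hne) (hLmem x) h
  have hLpre : ∀ i, L ⁻¹' {i} = P i := by
    intro i; ext x; simp [hLi]
  have hL : Measurable L := measurable_to_countable' fun i => by rw [hLpre]; exact hPm i
  have hLe : ∑' i, ENNReal.ofReal (negMulLog (μ (L ⁻¹' {i})).toReal) ≠ ⊤ := by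
    simp_rw [hLpre]; exact hPe.ne
  have hdyn : ∀ n, partitionEntropy μ (dynRefine f P n) =
      Hent μ (fun x (k : Fin n) => L (f^[k] x)) := by
    intro n
    unfold Hent partitionEntropy
    refine tsum_congr fun a => ?_
    congr 4
    ext x
    simp [dynRefine, funext_iff, hLi]
  simp_rw [hdyn]
  refine liminf_le_aux fun δ hδ => ?_
  have hδ2 : 0 < δ / 2 := by positivity
  -- truncation
  have htail := ENNReal.tendsto_sum_nat_add _ hLe
  obtain ⟨M, hM⟩ := (htail.eventually (gt_mem_nhds
    (show (0 : ℝ≥0∞) < ((δ / 2 : NNReal) : ℝ≥0∞) by exact_mod_cast hδ2))).exists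
  let g : ℕ → Fin M → Bool := fun l i => decide (l = (i : ℕ))
  have hg : ∀ l l', l < M → g l' = g l → l' = l := by
    intro l l' hl h
    have := congrFun h ⟨l, hl⟩
    simpa [g] using this
  have hgm : Measurable g := Measurable.of_discrete
  obtain ⟨ε, hε, H⟩ := Hcond_small (Fin M → Bool) (δ := ((δ / 2 : NNReal) : ℝ))
    (by exact_mod_cast hδ2)
  have hε' : 0 < ε / (M + 1) := by positivity
  choose c hc using fun i : Fin M => happ (P i) (hPm i) _ hε'
  refine ⟨fun n => GG f (fun i => φ (c i)) n μ, 0, by simp, hB M c, fun n => ?_⟩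
  set m := μ.prod lam with hm
  have hLf : Measurable (fun y : X × ℝ => L y.1) := hL.comp measurable_fst
  have hv : Measurable (fun y : X × ℝ => g (L y.1)) := hgm.comp hLf
  have hz : Measurable (zeta (fun i => φ (c i))) := measurable_zeta fun i => hφ (c i)
  have s1 := Hent_iter_le (mp_iter hf) hLf hv n
  have s2 := Hent_iter_le (mp_iter hf) hv hz n
  have t1 : Hcond m (fun y : X × ℝ => L y.1) (fun y : X × ℝ => g (L y.1)) ≤
      ((δ / 2 : NNReal) : ℝ≥0∞) := by
    have e := Hcond_mp (measurePreserving_fst (μ := μ) (ν := lam)) hL (hgm.comp hL)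
    exact (le_of_eq e).trans <| (Hcond_tail μ L g M hg).trans hM.le
  have t2 : Hcond m (fun y : X × ℝ => g (L y.1)) (zeta (fun i => φ (c i))) ≤
      ((δ / 2 : NNReal) : ℝ≥0∞) := by
    rw [← ENNReal.ofReal_coe_nnreal]
    refine H m _ _ hv hz ?_
    refine (prod_ne_le hv hz (fun i x => ENNReal.ofReal
      |φ (c i) x - (P i).indicator (fun _ => (1 : ℝ)) x|) ?_).trans ?_
    · intro i x
      by_cases hx : x ∈ P i
      · rw [Set.indicator_of_mem hx]
        refine (lam_le_of_subset (a := φ (c i) x) (b := 1) ?_).trans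
          (ENNReal.ofReal_le_ofReal ?_)
        · intro t ht _ ht1
          refine ⟨?_, ht1⟩
          have hLx : L x = i := (hLi x i).2 hx
          by_contra hlt
          apply ht
          simp [g, zeta, hLx, not_le.1 hlt]
        · rw [abs_sub_comm]; exact le_abs_self _
      · rw [Set.indicator_of_notMem hx, sub_zero]
        refine (lam_le_of_subset (a := 0) (b := φ (c i) x) ?_).trans
          (ENNReal.ofReal_le_ofReal ?_)
        · intro t ht ht0 _
          refine ⟨ht0, ?_⟩
          have hLx : L x ≠ i := fun h => hx ((hLi x i).1 h)
          by_contra hlt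
          apply ht
          simp [g, zeta, hLx, (not_le.1 hlt).le]
        · rw [sub_zero]; exact le_abs_self _
    · refine (Finset.sum_le_sum fun i _ => hc i).trans ?_
      rw [Finset.sum_const, Finset.card_univ, Fintype.card_fin, nsmul_eq_mul,
        ← ENNReal.ofReal_natCast, ← ENNReal.ofReal_mul (by positivity)]
      apply ENNReal.ofReal_le_ofReal
      rw [mul_div_assoc', div_le_iff₀ (by positivity)]
      nlinarith
  have mL : Measurable (fun x (k : Fin n) => L (f^[k] x)) :=
    measurable_pi_lambda _ fun k => hL.comp (hf.measurable.iterate k)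
  rw [← Hent_mp (measurePreserving_fst (μ := μ) (ν := lam)) mL]
  have hsplit : (δ : ℝ≥0∞) = ((δ / 2 : NNReal) : ℝ≥0∞) + ((δ / 2 : NNReal) : ℝ≥0∞) := by
    norm_cast; exact (add_halves δ).symm
  calc _ ≤ _ := s1
    _ ≤ (GG f (fun i => φ (c i)) n μ + n * ((δ / 2 : NNReal) : ℝ≥0∞)) +
        n * ((δ / 2 : NNReal) : ℝ≥0∞) := by
        refine add_le_add (s2.trans ?_) (by gcongr)
        unfold GG
        gcongr
    _ = _ := by rw [hsplit]; ring

end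

end EntGd

namespace EntGd

open Topology

section approx
variable {X : Type*} [MetricSpace X] [SecondCountableTopology X]

/-- Index set of the countable approximating family. -/
abbrev Idx (X : Type*) [MetricSpace X] [SecondCountableTopology X] : Type _ :=
  Finset (TopologicalSpace.countableBasis X) × ℕ

/-- Open set attached to a finite family of basic open sets. -/
def opn (s : Finset (TopologicalSpace.countableBasis X)) : Set X := ⋃ b ∈ s, (b : Set X)

lemma isOpen_opn (s : Finset (TopologicalSpace.countableBasis X)) : IsOpen (opn s) :=
  isOpen_biUnion fun b _ => TopologicalSpace.isOpen_of_mem_countableBasis b.2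

/-- Countable family of continuous functions. -/
noncomputable def phi (c : Idx X) (x : X) : ℝ :=
  (thickenedIndicator (δ := 1 / ((c.2 : ℝ) + 1)) (by positivity) (opn c.1)ᶜ x : ℝ)

lemma continuous_phi (c : Idx X) : Continuous (phi c) := by
  unfold phi
  exact NNReal.continuous_coe.comp (BoundedContinuousFunction.continuous _)

lemma exists_finset_opn [MeasurableSpace X] [BorelSpace X] (μ : Measure X) [IsProbabilityMeasure μ]
    {U : Set X} (hU : IsOpen U) {ε : ℝ≥0∞} (hε : ε ≠ 0) :
    ∃ s : Finset (TopologicalSpace.countableBasis X), opn s ⊆ U ∧ μ (U \ opn s) ≤ ε := by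
  classical
  let J := {b : TopologicalSpace.countableBasis X // (b : Set X) ⊆ U}
  have hUe : U = ⋃ s : Finset J, ⋃ b ∈ s, (b.1 : Set X) := by
    rw [← Set.iUnion_eq_iUnion_finset]
    conv_lhs => rw [(TopologicalSpace.isBasis_countableBasis X).open_eq_sUnion' hU]
    ext x
    simp only [Set.mem_sUnion, Set.mem_iUnion]
    constructor
    · rintro ⟨t, ⟨ht, htU⟩, hx⟩
      exact ⟨⟨⟨t, ht⟩, htU⟩, hx⟩
    · rintro ⟨⟨⟨t, ht⟩, htU⟩, hx⟩
      exact ⟨t, ⟨ht, htU⟩, hx⟩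
  have hdir : Directed (· ⊆ ·) fun s : Finset J => ⋃ b ∈ s, (b.1 : Set X) := by
    apply Monotone.directed_le
    intro s t hst
    exact Set.biUnion_subset_biUnion_left hst
  have hm := hdir.measure_iUnion (μ := μ)
  rw [← hUe] at hm
  have hlt : μ U < ⨆ s : Finset J, (μ (⋃ b ∈ s, (b.1 : Set X)) + ε) := by
    rw [← ENNReal.iSup_add, ← hm]
    exact ENNReal.lt_add_right (measure_ne_top _ _) hε
  obtain ⟨s, hs⟩ := lt_iSup_iff.1 hlt
  have he : opn (s.map (Function.Embedding.subtype _)) = ⋃ b ∈ s, (b.1 : Set X) := by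
    ext x
    simp only [opn, Finset.mem_map, Function.Embedding.subtype_apply, Set.mem_iUnion, exists_prop]
    constructor
    · rintro ⟨b, ⟨c, hc, rfl⟩, hx⟩
      exact ⟨c, hc, hx⟩
    · rintro ⟨c, hc, hx⟩
      exact ⟨c.1, ⟨c, hc, rfl⟩, hx⟩
  have hsub : opn (s.map (Function.Embedding.subtype _)) ⊆ U := by
    rw [he]
    exact Set.iUnion₂_subset fun b _ => b.2
  refine ⟨_, hsub, ?_⟩
  rw [measure_sdiff hsub (isOpen_opn _).measurableSet.nullMeasurableSet (measure_ne_top _ _), he]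
  exact tsub_le_iff_left.2 hs.le

lemma phi_approx [MeasurableSpace X] [BorelSpace X] (μ : Measure X) [IsProbabilityMeasure μ]
    (A : Set X) (hA : MeasurableSet A) (ε : ℝ) (hε : 0 < ε) :
    ∃ c : Idx X, ∫⁻ x, ENNReal.ofReal |phi c x - A.indicator (fun _ => (1 : ℝ)) x| ∂μ
      ≤ ENNReal.ofReal ε := by
  have h3 : ENNReal.ofReal (ε / 3) ≠ 0 := by
    have : 0 < ε / 3 := by positivity
    simpa using this
  obtain ⟨U, hUA, hU, -, hUe⟩ := hA.compl.exists_isOpen_sdiff_lt (measure_ne_top μ _) h3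
  obtain ⟨s, hsU, hs⟩ := exists_finset_opn μ hU h3
  have hF : IsClosed (opn s)ᶜ := (isOpen_opn s).isClosed_compl
  have ht := tendsto_lintegral_thickenedIndicator_of_isClosed μ hF
    (δs := fun n : ℕ => 1 / ((n : ℝ) + 1)) (fun n => by positivity)
    tendsto_one_div_add_atTop_nhds_zero_nat
  obtain ⟨n, hn⟩ := (ht.eventually (gt_mem_nhds
    (ENNReal.lt_add_right (measure_ne_top μ (opn s)ᶜ) h3))).exists
  refine ⟨(s, n), ?_⟩
  set F := (opn s)ᶜ with hFdef
  have e1 : μ (F \ A) ≤ ENNReal.ofReal (ε / 3) := by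
    refine (measure_mono ?_).trans hs
    intro x hx
    exact ⟨hUA hx.2, hx.1⟩
  have e2 : μ (A \ F) ≤ ENNReal.ofReal (ε / 3) := by
    refine (measure_mono ?_).trans hUe.le
    intro x hx
    refine ⟨hsU (by simpa [hFdef] using hx.2), by simpa using hx.1⟩
  have hFm := hF.measurableSet
  have key : ∫⁻ x, ENNReal.ofReal |phi (s, n) x - A.indicator (fun _ => (1 : ℝ)) x| ∂μ + μ F
      ≤ ENNReal.ofReal ε + μ F := by
    calc _ = ∫⁻ x, (ENNReal.ofReal |phi (s, n) x - A.indicator (fun _ => (1 : ℝ)) x|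
            + F.indicator 1 x) ∂μ := by
          rw [lintegral_add_right _ (measurable_one.indicator hFm), lintegral_indicator_one hFm]
      _ ≤ ∫⁻ x, ((thickenedIndicator (δ := 1 / ((n : ℝ) + 1)) (by positivity) F x : ℝ≥0∞)
            + ((F \ A).indicator 1 x + (A \ F).indicator 1 x)) ∂μ := by
          refine lintegral_mono fun x => ?_
          have t0 : 0 ≤ phi (s, n) x := NNReal.coe_nonneg _
          have t1 : phi (s, n) x ≤ 1 := by
            exact_mod_cast thickenedIndicator_le_one _ _ x
          have t2 : (thickenedIndicator (δ := 1 / ((n : ℝ) + 1)) (by positivity) F x : ℝ≥0∞)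
              = ENNReal.ofReal (phi (s, n) x) := by
            simp [phi, hFdef]
          have t3 : x ∈ F → phi (s, n) x = 1 := fun hx => by
            have := thickenedIndicator_one (δ := 1 / ((n : ℝ) + 1)) (by positivity) F hx
            unfold phi
            exact_mod_cast this
          rw [t2]
          by_cases hxF : x ∈ F <;> by_cases hxA : x ∈ A
          · simp [hxF, hxA, t3 hxF]
          · simp [hxF, hxA, t3 hxF]
          · simp [hxF, hxA]
            rw [abs_sub_comm, abs_of_nonneg (by linarith)]
            refine le_trans ?_ le_add_self
            rw [← ENNReal.ofReal_one]
            exact ENNReal.ofReal_le_ofReal (by linarith)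
          · simp [hxF, hxA, abs_of_nonneg t0]
      _ = _ + (μ (F \ A) + μ (A \ F)) := by
          rw [lintegral_add_right _ (by
            exact (measurable_one.indicator (hFm.diff hA)).add
              (measurable_one.indicator (hA.diff hFm))),
            lintegral_add_right _ (measurable_one.indicator (hA.diff hFm)),
            lintegral_indicator_one (hFm.diff hA), lintegral_indicator_one (hA.diff hFm)]
      _ ≤ (μ F + ENNReal.ofReal (ε / 3)) + (ENNReal.ofReal (ε / 3) + ENNReal.ofReal (ε / 3)) := by
          gcongr
      _ = ENNReal.ofReal ε + μ F := by
          have : ENNReal.ofReal ε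
              = ENNReal.ofReal (ε / 3) + ENNReal.ofReal (ε / 3) + ENNReal.ofReal (ε / 3) := by
            rw [← ENNReal.ofReal_add (by positivity) (by positivity),
              ← ENNReal.ofReal_add (by positivity) (by positivity)]
            congr 1; ring
          rw [this]; ring
  exact (ENNReal.add_le_add_iff_right (measure_ne_top _ _)).1 key

end approx

section cont
variable {X : Type*} [MetricSpace X] [SecondCountableTopology X] [MeasurableSpace X] [BorelSpace X]

lemma continuous_GG {f : X → X} (hf : Continuous f) {M : ℕ} {φ : Fin M → X → ℝ}
    (hφ : ∀ i, Continuous (φ i)) (n : ℕ) :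
    Continuous fun μ : ProbabilityMeasure X => GG f φ n (μ : Measure X) := by
  unfold GG Hent
  simp only [tsum_fintype]
  refine continuous_finsetSum _ fun a _ => ?_
  refine ENNReal.continuous_ofReal.comp (Real.continuous_negMulLog.comp ?_)
  set ξ : X × ℝ → Fin n → Fin M → Bool := fun y k => zeta φ (f^[k] y.1, y.2) with hξ
  have hξm : Measurable ξ := by
    refine measurable_pi_lambda _ fun k => ?_
    exact (measurable_zeta fun i => (hφ i).measurable).comp
      (((hf.iterate k).measurable.comp measurable_fst).prodMk measurable_snd)
  have hS : MeasurableSet (ξ ⁻¹' {a}) := hξm (measurableSet_singleton a)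
  set g : X → ℝ := fun x => (lam (Prod.mk x ⁻¹' (ξ ⁻¹' {a}))).toReal with hg
  have hgi : ∀ x, g x = ∫ t, (Prod.mk x ⁻¹' (ξ ⁻¹' {a})).indicator (fun _ => (1 : ℝ)) t ∂lam := by
    intro x
    rw [integral_indicator (measurable_prodMk_left hS)]
    simp [hg, Measure.real]
  have hgc : Continuous g := by
    rw [continuous_iff_continuousAt]
    intro x₀
    rw [show g = _ from funext hgi]
    refine continuousAt_of_dominated (bound := fun _ => 1) ?_ ?_ (integrable_const _) ?_
    · exact Eventually.of_forall fun x =>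
        (stronglyMeasurable_const.indicator (measurable_prodMk_left hS)).aestronglyMeasurable
    · refine Eventually.of_forall fun x => Eventually.of_forall fun t => ?_
      by_cases h : t ∈ Prod.mk x ⁻¹' (ξ ⁻¹' {a})
      · rw [Set.indicator_of_mem h]; simp
      · rw [Set.indicator_of_notMem h]; simp
    · have hae : ∀ᵐ t ∂lam, ∀ (k : Fin n) (i : Fin M), t ≠ φ i (f^[k] x₀) := by
        rw [ae_all_iff]; intro k
        rw [ae_all_iff]; intro i
        refine ae_restrict_of_ae ?_
        exact Measure.ae_ne volume _
      filter_upwards [hae] with t ht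
      have hev : ∀ᶠ x in 𝓝 x₀, ξ (x, t) = ξ (x₀, t) := by
        have : ∀ᶠ x in 𝓝 x₀, ∀ (k : Fin n) (i : Fin M),
            (t < φ i (f^[k] x) ↔ t < φ i (f^[k] x₀)) := by
          rw [eventually_all]; intro k
          rw [eventually_all]; intro i
          have hc : Continuous fun x => φ i (f^[k] x) := (hφ i).comp (hf.iterate k)
          rcases lt_or_gt_of_ne (ht k i) with h | h
          · filter_upwards [hc.continuousAt.eventually (lt_mem_nhds h)] with x hx
            exact ⟨fun _ => h, fun _ => hx⟩
          · filter_upwards [hc.continuousAt.eventually (gt_mem_nhds h)] with x hx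
            exact ⟨fun h' => absurd h' hx.not_gt, fun h' => absurd h' h.not_gt⟩
        filter_upwards [this] with x hx
        funext k i
        simp only [hξ, zeta, hx k i]
      refine (continuousAt_const (y := (Prod.mk x₀ ⁻¹' (ξ ⁻¹' {a})).indicator
        (fun _ => (1 : ℝ)) t)).congr ?_
      filter_upwards [hev] with x hx
      simp only [Set.indicator, Set.mem_preimage, hx]
  have hgb : ∀ x, ‖g x‖ ≤ 1 := by
    intro x
    rw [Real.norm_of_nonneg ENNReal.toReal_nonneg]
    exact ENNReal.toReal_le_of_le_ofReal zero_le_one (by simpa using prob_le_one)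
  let G : BoundedContinuousFunction X ℝ := BoundedContinuousFunction.ofNormedAddCommGroup g hgc 1 hgb
  have hint : ∀ μ : ProbabilityMeasure X,
      (((μ : Measure X).prod lam) (ξ ⁻¹' {a})).toReal = ∫ x, G x ∂(μ : Measure X) := by
    intro μ
    rw [Measure.prod_apply hS]
    exact (integral_toReal (measurable_measure_prodMk_left hS).aemeasurable
      (Eventually.of_forall fun x => measure_lt_top _ _)).symm
  simp only [hint]
  rw [continuous_iff_continuousAt]
  intro μ
  exact (ProbabilityMeasure.tendsto_iff_forall_integral_tendsto.1 tendsto_id) G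

lemma isGdelta_liminf {Z : Type*} [TopologicalSpace Z] {a : ℕ → Z → ℝ≥0∞}
    (ha : ∀ n, Continuous (a n)) (α : ℝ) :
    IsGδ {z | liminf (fun n : ℕ => a n z / (n : ℝ≥0∞)) atTop ≤ ENNReal.ofReal α} := by
  have h : {z | liminf (fun n : ℕ => a n z / (n : ℝ≥0∞)) atTop ≤ ENNReal.ofReal α}
      = ⋂ j : ℕ, ⋂ N : ℕ, {z | ∃ n, N + 1 ≤ n ∧
        a n z / (n : ℝ≥0∞) < ENNReal.ofReal α + ((j : ℝ≥0∞) + 1)⁻¹} := by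
    ext z
    simp only [Set.mem_setOf_eq, Set.mem_iInter]
    constructor
    · intro hz j N
      have hlt : liminf (fun n : ℕ => a n z / (n : ℝ≥0∞)) atTop
          < ENNReal.ofReal α + ((j : ℝ≥0∞) + 1)⁻¹ :=
        hz.trans_lt (ENNReal.lt_add_right ENNReal.ofReal_ne_top (by simp))
      have hfr := frequently_lt_of_liminf_lt (by isBoundedDefault) hlt
      exact frequently_atTop.1 hfr (N + 1)
    · intro hz
      refine ENNReal.le_of_forall_pos_le_add fun ε hε _ => ?_
      obtain ⟨j, hj⟩ := ENNReal.exists_inv_nat_lt (a := (ε : ℝ≥0∞)) (by exact_mod_cast hε.ne')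
      refine liminf_le_of_frequently_le' (frequently_atTop.2 fun N => ?_)
      obtain ⟨n, hn, h⟩ := hz j N
      refine ⟨n, by omega, h.le.trans ?_⟩
      gcongr
      refine le_trans ?_ hj.le
      gcongr
      exact le_self_add
  rw [h]
  refine IsGδ.iInter fun j => IsGδ.iInter fun N => IsOpen.isGδ ?_
  have : {z | ∃ n, N + 1 ≤ n ∧ a n z / (n : ℝ≥0∞) < ENNReal.ofReal α + ((j : ℝ≥0∞) + 1)⁻¹}
      = ⋃ n : ℕ, ⋃ _ : N + 1 ≤ n,
        {z | a n z / (n : ℝ≥0∞) < ENNReal.ofReal α + ((j : ℝ≥0∞) + 1)⁻¹} := by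
    ext z; simp
  rw [this]
  refine isOpen_iUnion fun n => isOpen_iUnion fun hn => ?_
  refine isOpen_lt ?_ continuous_const
  exact (ENNReal.continuous_div_const _ (by
    have : n ≠ 0 := by omega
    exact_mod_cast this)).comp (ha n)

end cont

end EntGd

theorem stmt12 {X : Type*} [MetricSpace X] [PolishSpace X] [MeasurableSpace X] [BorelSpace X]
    (f : X → X) (hf : UniformContinuous f) (α : ℝ) (hα : 0 < α) :
    IsGδ {μ : {ν : ProbabilityMeasure X // Ergodic f (ν : Measure X)} |
      metricEntropy ((μ : ProbabilityMeasure X) : Measure X) f ≤ ENNReal.ofReal α} := by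
  have hc : Continuous f := hf.continuous
  have hset : {μ : {ν : ProbabilityMeasure X // Ergodic f (ν : Measure X)} |
      metricEntropy ((μ : ProbabilityMeasure X) : Measure X) f ≤ ENNReal.ofReal α}
      = ⋂ M : ℕ, ⋂ c : Fin M → EntGd.Idx X,
        {μ : {ν : ProbabilityMeasure X // Ergodic f (ν : Measure X)} |
          liminf (fun n : ℕ => EntGd.GG f (fun i => EntGd.phi (c i)) n
            ((μ : ProbabilityMeasure X) : Measure X) / (n : ℝ≥0∞)) atTop ≤ ENNReal.ofReal α} := by
    ext μ
    simp only [Set.mem_setOf_eq, Set.mem_iInter]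
    constructor
    · intro h M c
      exact (EntGd.liminf_GG_le μ.2.toMeasurePreserving
        fun i => (EntGd.continuous_phi (c i)).measurable).trans h
    · intro h
      exact EntGd.metricEntropy_le μ.2.toMeasurePreserving
        (fun c => (EntGd.continuous_phi c).measurable)
        (EntGd.phi_approx ((μ : ProbabilityMeasure X) : Measure X)) h
  rw [hset]
  refine IsGδ.iInter fun M => IsGδ.iInter fun c => ?_
  exact EntGd.isGdelta_liminf (fun n => (EntGd.continuous_GG hc
    (fun i => EntGd.continuous_phi (c i)) n).comp continuous_subtype_val) α
end

section
/- Let X be a Polish metric space and f : X → X uniformly continuous. Then the set E₀^e(f) = {μ ∈ M_e(f) : h_μ(f) = 0} of ergodic measures with zero metric entropy is a G_δ subset of M_e(f). Moreover, if the set of ergodic measures M_e(f) is a G_δ subset of M(f), then E₀(f) = {μ ∈ M(f) : h_μ(f) = 0} being dense in M(f) implies E₀(f) contains a dense G_δ subset of M(f). -/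
open Metric

open MeasureTheory Filter
open scoped ENNReal

/-- Gibbs inequality. -/
lemma gibbs_ineq {ι : Type*} (p q : ι → ℝ) (hp : ∀ i, 0 ≤ p i) (hp1 : ∀ i, p i ≤ 1)
    (hq : ∀ i, 0 < q i)
    (hps : ∑' i, ENNReal.ofReal (p i) = 1) (hqs : ∑' i, ENNReal.ofReal (q i) ≤ 1) :
    ∑' i, ENNReal.ofReal (Real.negMulLog (p i)) ≤
      ∑' i, ENNReal.ofReal (-Real.log (q i)) * ENNReal.ofReal (p i) := by
  have key : ∀ i, ENNReal.ofReal (Real.negMulLog (p i)) + ENNReal.ofReal (p i) ≤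
      ENNReal.ofReal (-Real.log (q i)) * ENNReal.ofReal (p i) + ENNReal.ofReal (q i) := by
    intro i
    rw [← ENNReal.ofReal_add (Real.negMulLog_nonneg (hp i) (hp1 i)) (hp i),
      ← ENNReal.ofReal_mul' (hp i)]
    refine le_trans (ENNReal.ofReal_le_ofReal ?_) ENNReal.ofReal_add_le
    rcases (hp i).eq_or_lt with h | h
    · rw [← h]; simp [(hq i).le]
    · have h1 := Real.log_le_sub_one_of_pos (div_pos (hq i) h)
      rw [Real.log_div (hq i).ne' h.ne'] at h1
      have h2 := mul_le_mul_of_nonneg_left h1 h.le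
      have h3 : p i * (q i / p i - 1) = q i - p i := by field_simp
      rw [Real.negMulLog]
      nlinarith
  have h := ENNReal.tsum_le_tsum key
  rw [ENNReal.tsum_add, ENNReal.tsum_add, hps] at h
  have h' := h.trans (add_le_add_right hqs _)
  exact (ENNReal.add_le_add_iff_right ENNReal.one_ne_top).1 h'

lemma tsum_pi_prod_le (n : ℕ) (g : Fin n → ℕ → ℝ≥0∞) (hg : ∀ i, ∑' b, g i b ≤ 1) :
    ∑' b : Fin n → ℕ, ∏ i, g i (b i) ≤ 1 := by
  induction n with
  | zero => simp
  | succ n ih =>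
    rw [← (Fin.consEquiv (fun _ : Fin (n+1) => ℕ)).tsum_eq, ENNReal.tsum_prod']
    simp only [Fin.consEquiv, Equiv.coe_fn_mk, Fin.prod_univ_succ, Fin.cons_zero, Fin.cons_succ]
    simp_rw [ENNReal.tsum_mul_left]
    rw [ENNReal.tsum_mul_right]
    exact mul_le_one' (hg 0) (ih _ fun i => hg _)

lemma exists_weight {X : Type*} [MeasurableSpace X] (μ : Measure X) [IsProbabilityMeasure μ]
    (P : ℕ → Set X) (hP : IsMeasPartition P) (hH : partitionEntropy μ P < ⊤) :
    ∃ p : ℕ → ℝ, (∀ b, 0 < p b) ∧ (∀ b, p b ≤ 1) ∧ ∑' b, ENNReal.ofReal (p b) ≤ 1 ∧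
      ∑' b, ENNReal.ofReal (-Real.log (p b)) * μ (P b) < ⊤ := by
  have hsum : ∑' b, μ (P b) = 1 := by
    rw [← measure_iUnion hP.2.1 hP.1, hP.2.2, measure_univ]
  have hlt : ∀ b, μ (P b) ≠ ⊤ := fun b => measure_ne_top _ _
  have hm1 : ∀ b, (μ (P b)).toReal ≤ 1 := fun b =>
    ENNReal.toReal_le_of_le_ofReal zero_le_one (by simpa using prob_le_one)
  have hgeo : ∀ b : ℕ, (1/2 : ℝ) ^ (b+1) ≤ 1 := fun b => pow_le_one₀ (by norm_num) (by norm_num)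
  refine ⟨fun b => ((μ (P b)).toReal + (1/2) ^ (b+1)) / 2, fun b => by positivity, fun b => ?_,
    ?_, ?_⟩
  · have := hm1 b; have := hgeo b; simp only; linarith
  · have h : ∀ b, ENNReal.ofReal (((μ (P b)).toReal + (1/2) ^ (b+1)) / 2) =
        (μ (P b) + (1/2) ^ (b+1)) / 2 := by
      intro b
      rw [ENNReal.ofReal_div_of_pos two_pos, ENNReal.ofReal_add (by positivity) (by positivity),
        ENNReal.ofReal_toReal (hlt b), ENNReal.ofReal_pow (by positivity)]
      congr
      · rw [ENNReal.ofReal_div_of_pos two_pos]; simp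
      · simp
    simp_rw [h, div_eq_mul_inv]
    rw [ENNReal.tsum_mul_right, ENNReal.tsum_add, hsum]
    have : ∑' i : ℕ, ((1:ℝ≥0∞) * 2⁻¹) ^ (i+1) = 1 := by
      simp [ENNReal.tsum_geometric_add_one]
      rw [ENNReal.inv_mul_cancel] <;> simp
    rw [this, one_add_one_eq_two, ENNReal.mul_inv_cancel] <;> simp
  · have key : ∀ b, ENNReal.ofReal (-Real.log (((μ (P b)).toReal + (1/2) ^ (b+1)) / 2)) * μ (P b)
        ≤ ENNReal.ofReal (Real.negMulLog (μ (P b)).toReal) +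
          ENNReal.ofReal (Real.log 2) * μ (P b) := by
      intro b
      conv_lhs => rw [← ENNReal.ofReal_toReal (hlt b)]
      conv_rhs => rw [← ENNReal.ofReal_toReal (hlt b)]
      simp only [ENNReal.toReal_ofReal ENNReal.toReal_nonneg]
      rw [← ENNReal.ofReal_mul' ENNReal.toReal_nonneg, ← ENNReal.ofReal_mul' ENNReal.toReal_nonneg]
      have hm1 := hm1 b
      have hm0 : 0 ≤ (μ (P b)).toReal := ENNReal.toReal_nonneg
      generalize (μ (P b)).toReal = m at *
      rw [← ENNReal.ofReal_add (Real.negMulLog_nonneg hm0 hm1) (by positivity)]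
      apply ENNReal.ofReal_le_ofReal
      rcases hm0.eq_or_lt with h | h
      · simp [← h]
      · have h1 : Real.log (m/2) ≤ Real.log ((m + (1/2) ^ (b+1)) / 2) := by
          apply Real.log_le_log (by positivity)
          have : (0:ℝ) ≤ (1/2)^(b+1) := by positivity
          linarith
        rw [Real.log_div h.ne' two_ne_zero] at h1
        rw [Real.negMulLog]
        nlinarith
    refine (ENNReal.tsum_le_tsum key).trans_lt ?_
    rw [ENNReal.tsum_add, ENNReal.tsum_mul_left, hsum]
    exact ENNReal.add_lt_top.2 ⟨hH, by simp⟩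

/-- The open sets attached to a family of closed sets. -/
def coverSet {X : Type*} (G : ℕ → Set X) (j : ℕ) : Set X := {x | ∀ l, l ≠ j → x ∉ G l}

lemma log_code_le {n : ℕ} (S : Finset (Fin n → ℕ)) (κ : ℕ → ℕ → ℝ) (hκ : ∀ a b, 0 < κ a b)
    (a : Fin n → ℕ) (ha : a ∈ S) (b : Fin n → ℕ) :
    -Real.log ((∑ a ∈ S, ∏ i, κ (a i) (b i)) / S.card) ≤
      Real.log S.card + ∑ i, -Real.log (κ (a i) (b i)) := by
  have hS : (0:ℝ) < S.card := by exact_mod_cast Finset.card_pos.2 ⟨a, ha⟩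
  have hpos : ∀ a : Fin n → ℕ, 0 < ∏ i, κ (a i) (b i) := fun a => Finset.prod_pos fun i _ => hκ _ _
  have h1 : ∏ i, κ (a i) (b i) ≤ ∑ a ∈ S, ∏ i, κ (a i) (b i) :=
    Finset.single_le_sum (f := fun a : Fin n → ℕ => ∏ i, κ (a i) (b i))
      (fun a _ => (hpos a).le) ha
  have h2 := Real.log_le_log (hpos a) h1
  rw [Real.log_prod (fun i _ => (hκ _ _).ne')] at h2
  rw [Real.log_div ((hpos a).trans_le h1).ne' hS.ne', Finset.sum_neg_distrib]
  linarith

lemma entropy_bound {X : Type*} [MeasurableSpace X] (μ : Measure X) [IsProbabilityMeasure μ]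
    (f : X → X) (hf : MeasurePreserving f μ μ) (idx : X → ℕ) (hidx : Measurable idx)
    (p : ℕ → ℝ) (hp : ∀ b, 0 < p b) (hps : ∑' b, ENNReal.ofReal (p b) ≤ 1)
    (θ : ℝ) (hθ : 0 < θ) (hθ1 : θ < 1) (G : ℕ → Set X) (hG : ∀ l, MeasurableSet (G l))
    (M : ℝ≥0∞) (hM : ∀ x, x ∈ G (idx x) → ENNReal.ofReal (-Real.log (p (idx x))) ≤ M)
    (n : ℕ) (S : Finset (Fin n → ℕ)) (hS : S.Nonempty) (T : Set X) (hT : MeasurableSet T)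
    (hTS : T ⊆ ⋃ a ∈ S, dynRefine f (coverSet G) n a) :
    partitionEntropy μ (dynRefine f (fun b => idx ⁻¹' {b}) n) ≤
      ENNReal.ofReal (Real.log S.card) + n * (ENNReal.ofReal (-Real.log (1-θ)) +
        ∫⁻ x in {x | x ∉ G (idx x)},
          (ENNReal.ofReal (-Real.log θ) + ENNReal.ofReal (-Real.log (p (idx x)))) ∂μ +
        (ENNReal.ofReal (-Real.log θ) + M) * μ Tᶜ) := by
  classical
  set D : Set X := {x | x ∉ G (idx x)} with hD
  have hDm : MeasurableSet D := by
    have : D = (⋃ b, (idx ⁻¹' {b} ∩ G b))ᶜ := by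
      ext x; simp [hD]
    rw [this]
    exact (MeasurableSet.iUnion fun b => (hidx (measurableSet_singleton b)).inter (hG b)).compl
  set κ : ℕ → ℕ → ℝ := fun a b => (if b = a then 1 - θ else 0) + θ * p b with hκdef
  have hκ : ∀ a b, 0 < κ a b := by
    intro a b
    have := mul_pos hθ (hp b)
    simp only [hκdef]; split_ifs <;> linarith
  have hκs : ∀ a, ∑' b, ENNReal.ofReal (κ a b) ≤ 1 := by
    intro a
    have h : ∀ b, ENNReal.ofReal (κ a b) ≤
        (if b = a then ENNReal.ofReal (1 - θ) else 0) + ENNReal.ofReal θ * ENNReal.ofReal (p b) := by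
      intro b
      rw [← ENNReal.ofReal_mul hθ.le]
      refine ENNReal.ofReal_add_le.trans ?_
      split_ifs <;> simp
    refine (ENNReal.tsum_le_tsum h).trans ?_
    rw [ENNReal.tsum_add, ENNReal.tsum_mul_left, tsum_ite_eq]
    calc _ ≤ ENNReal.ofReal (1-θ) + ENNReal.ofReal θ * 1 := by gcongr
      _ = 1 := by
        rw [mul_one, ← ENNReal.ofReal_add (by linarith) hθ.le]; simp
  have hScard : (0:ℝ) < S.card := by exact_mod_cast Finset.card_pos.2 hS
  set q : (Fin n → ℕ) → ℝ := fun b => (∑ a ∈ S, ∏ i, κ (a i) (b i)) / S.card with hqdef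
  have hq : ∀ b, 0 < q b := fun b =>
    div_pos (Finset.sum_pos (fun a _ => Finset.prod_pos fun i _ => hκ _ _) hS) hScard
  have hqs : ∑' b, ENNReal.ofReal (q b) ≤ 1 := by
    have h : ∀ b, ENNReal.ofReal (q b) =
        (∑ a ∈ S, ∏ i, ENNReal.ofReal (κ (a i) (b i))) * (S.card : ℝ≥0∞)⁻¹ := by
      intro b
      rw [hqdef, ENNReal.ofReal_div_of_pos hScard, ENNReal.ofReal_natCast, div_eq_mul_inv,
        ENNReal.ofReal_sum_of_nonneg fun a _ => Finset.prod_nonneg fun i _ => (hκ _ _).le]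
      congr 1
      refine Finset.sum_congr rfl fun a _ => ?_
      rw [ENNReal.ofReal_prod_of_nonneg fun i _ => (hκ _ _).le]
    simp_rw [h]
    rw [ENNReal.tsum_mul_right, Summable.tsum_finsetSum fun i _ => ENNReal.summable]
    calc _ ≤ (∑ a ∈ S, (1:ℝ≥0∞)) * (S.card : ℝ≥0∞)⁻¹ := by
          gcongr with a ha
          exact tsum_pi_prod_le n (fun i b => ENNReal.ofReal (κ (a i) b)) fun i => hκs _
      _ = 1 := by
        simp only [Finset.sum_const, nsmul_eq_mul, mul_one]
        exact ENNReal.mul_inv_cancel (by simpa using hS.ne_empty) (by simp)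
  set B : X → (Fin n → ℕ) := fun x i => idx (f^[i] x) with hB
  have hBm : Measurable B := measurable_pi_lambda _ fun i => hidx.comp (hf.measurable.iterate i)
  have hBdyn : ∀ b, dynRefine f (fun b => idx ⁻¹' {b}) n b = B ⁻¹' {b} := by
    intro b; ext x; simp [dynRefine, hB, funext_iff]
  have hmap : ∀ b, μ.map B {b} = μ (B ⁻¹' {b}) := fun b =>
    Measure.map_apply hBm (measurableSet_singleton b)
  have hps' : ∑' b, ENNReal.ofReal (μ (B ⁻¹' {b})).toReal = 1 := by
    have : ∀ b, ENNReal.ofReal (μ (B ⁻¹' {b})).toReal = 1 * μ.map B {b} := fun b => by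
      rw [ENNReal.ofReal_toReal (measure_ne_top _ _), hmap, one_mul]
    simp_rw [this]
    rw [← lintegral_countable', lintegral_one, Measure.map_apply hBm MeasurableSet.univ]
    simp
  have hgibbs : partitionEntropy μ (dynRefine f (fun b => idx ⁻¹' {b}) n) ≤
      ∫⁻ x, ENNReal.ofReal (-Real.log (q (B x))) ∂μ := by
    unfold partitionEntropy
    simp_rw [hBdyn]
    refine (gibbs_ineq (fun b => (μ (B ⁻¹' {b})).toReal) q (fun b => ENNReal.toReal_nonneg)
      (fun b => ENNReal.toReal_le_of_le_ofReal zero_le_one (by simpa using prob_le_one))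
      hq hps' hqs).trans ?_
    rw [← lintegral_map (f := fun b => ENNReal.ofReal (-Real.log (q b))) (g := B)
      (measurable_of_countable _) hBm, lintegral_countable']
    refine ENNReal.tsum_le_tsum fun b => ?_
    rw [hmap, ENNReal.ofReal_toReal (measure_ne_top _ _)]
  refine hgibbs.trans ?_
  set Φ : X → ℝ≥0∞ := fun x =>
    ENNReal.ofReal (-Real.log θ) + ENNReal.ofReal (-Real.log (p (idx x))) with hΦ
  have hΦm : Measurable Φ :=
    measurable_const.add ((measurable_of_countable
      (fun b : ℕ => ENNReal.ofReal (-Real.log (p b)))).comp hidx)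
  set c := ENNReal.ofReal (-Real.log (1-θ))
  set C := ENNReal.ofReal (-Real.log θ)
  have hκ1 : ∀ a, ENNReal.ofReal (-Real.log (κ a a)) ≤ c := by
    intro a
    apply ENNReal.ofReal_le_ofReal
    have := mul_pos hθ (hp a)
    have := Real.log_le_log (x := 1 - θ) (y := κ a a) (by linarith) (by simp [hκdef]; linarith)
    linarith
  have hκ2 : ∀ a x, ENNReal.ofReal (-Real.log (κ a (idx x))) ≤ Φ x := by
    intro a x
    have h0 := mul_pos hθ (hp (idx x))
    have h1 : Real.log (θ * p (idx x)) ≤ Real.log (κ a (idx x)) := by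
      apply Real.log_le_log h0
      simp only [hκdef]; split_ifs <;> linarith
    rw [Real.log_mul hθ.ne' (hp _).ne'] at h1
    refine (ENNReal.ofReal_le_ofReal (q := -Real.log θ + -Real.log (p (idx x))) (by linarith)).trans
      ENNReal.ofReal_add_le
  have hpt : ∀ x, ENNReal.ofReal (-Real.log (q (B x))) ≤ ENNReal.ofReal (Real.log S.card) +
      ∑ i : Fin n, (c + D.indicator Φ (f^[i] x) + Tᶜ.indicator (fun _ => C + M) x) := by
    intro x
    have gen : ∀ a ∈ S, (∀ i : Fin n, ENNReal.ofReal (-Real.log (κ (a i) (B x i))) ≤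
        c + D.indicator Φ (f^[i] x) + Tᶜ.indicator (fun _ => C + M) x) →
        ENNReal.ofReal (-Real.log (q (B x))) ≤ ENNReal.ofReal (Real.log S.card) +
      ∑ i : Fin n, (c + D.indicator Φ (f^[i] x) + Tᶜ.indicator (fun _ => C + M) x) := by
      intro a ha h
      refine (ENNReal.ofReal_le_ofReal (log_code_le S κ hκ a ha (B x))).trans ?_
      refine ENNReal.ofReal_add_le.trans ?_
      gcongr
      refine le_trans ?_ (Finset.sum_le_sum fun i _ => h i)
      exact Finset.le_sum_of_subadditive _ ENNReal.ofReal_zero.le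
        (fun _ _ => ENNReal.ofReal_add_le) _ _
    by_cases hxT : x ∈ T
    · have := hTS hxT
      simp only [Set.mem_iUnion] at this
      obtain ⟨a, ha, hxa⟩ := this
      refine gen a ha fun i => ?_
      by_cases hi : idx (f^[i] x) = a i
      · have : B x i = a i := hi
        rw [this]
        exact (hκ1 _).trans (by rw [add_assoc]; exact le_self_add)
      · have hmem : f^[i] x ∈ D := by
          simp only [dynRefine, Set.mem_iInter, Set.mem_preimage] at hxa
          exact hxa i _ hi
        rw [Set.indicator_of_mem hmem]
        refine (hκ2 (a i) (f^[i] x)).trans ?_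
        rw [add_comm c, add_assoc]; exact le_self_add
    · obtain ⟨a, ha⟩ := hS
      refine gen a ha fun i => ?_
      refine (hκ2 (a i) (f^[i] x)).trans ?_
      by_cases hmem : f^[i] x ∈ D
      · rw [Set.indicator_of_mem hmem, add_comm c, add_assoc]; exact le_self_add
      · rw [Set.indicator_of_mem (show x ∈ Tᶜ from hxT)]
        refine le_trans ?_ le_add_self
        have : f^[i] x ∈ G (idx (f^[i] x)) := not_not.1 hmem
        exact add_le_add_right (hM _ this) _
  refine (lintegral_mono hpt).trans ?_
  have hDi : ∀ i : Fin n, Measurable fun x => D.indicator Φ (f^[i] x) := fun i =>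
    (hΦm.indicator hDm).comp (hf.measurable.iterate i)
  have hTi : Measurable (Tᶜ.indicator (fun _ => C + M)) := measurable_const.indicator hT.compl
  rw [lintegral_add_left measurable_const, lintegral_const, measure_univ, mul_one,
    lintegral_finsetSum (s := Finset.univ) (f := fun (i : Fin n) x =>
      c + D.indicator Φ (f^[i] x) + Tᶜ.indicator (fun _ => C + M) x)
      fun i _ => (measurable_const.add (hDi i)).add hTi]
  gcongr
  have : ∀ i : Fin n, ∫⁻ x, (c + D.indicator Φ (f^[i] x) + Tᶜ.indicator (fun _ => C + M) x) ∂μ =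
      c + ∫⁻ x in D, Φ x ∂μ + (C + M) * μ Tᶜ := by
    intro i
    rw [lintegral_add_right _ hTi, lintegral_add_left measurable_const, lintegral_const,
      measure_univ, mul_one, lintegral_indicator_const hT.compl,
      (hf.iterate i).lintegral_comp (hΦm.indicator hDm), lintegral_indicator hDm]
  simp_rw [this]
  rw [Finset.sum_const, Finset.card_univ, Fintype.card_fin, nsmul_eq_mul]

lemma exists_closed_family (X : Type*) [TopologicalSpace X] [SecondCountableTopology X]
    [RegularSpace X] :
    ∃ 𝒞 : Set (Set X), 𝒞.Countable ∧ (∀ C ∈ 𝒞, IsClosed C) ∧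
      ∀ K V : Set X, IsCompact K → IsOpen V → K ⊆ V → ∃ C ∈ 𝒞, K ⊆ C ∧ C ⊆ V := by
  classical
  obtain ⟨B, hBc, -, hB⟩ := TopologicalSpace.exists_countable_basis X
  have := hBc.to_subtype
  refine ⟨Set.range fun F : Finset B => ⋃ b ∈ F, closure (b : Set X), Set.countable_range _,
    ?_, ?_⟩
  · rintro _ ⟨F, rfl⟩
    exact F.finite_toSet.isClosed_biUnion fun b _ => isClosed_closure
  · intro K V hK hV hKV
    have h : ∀ x : K, ∃ b : B, (x : X) ∈ (b : Set X) ∧ closure (b : Set X) ⊆ V := by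
      intro x
      obtain ⟨t, ht, hx, hc⟩ := hB.exists_closure_subset (hV.mem_nhds (hKV x.2))
      exact ⟨⟨t, ht⟩, hx, hc⟩
    choose b hb hbV using h
    obtain ⟨F, hF⟩ := hK.elim_finite_subcover (fun x : K => (b x : Set X))
      (fun x => hB.isOpen (b x).2) fun x hx => Set.mem_iUnion.2 ⟨⟨x, hx⟩, hb _⟩
    refine ⟨_, ⟨F.image b, rfl⟩, fun x hx => ?_, ?_⟩
    · have := hF hx
      simp only [Set.mem_iUnion] at this ⊢
      obtain ⟨y, hy, hxy⟩ := this
      exact ⟨b y, Finset.mem_image_of_mem b hy, subset_closure hxy⟩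
    · simp only [Set.iUnion_subset_iff]
      intro c hc
      obtain ⟨y, -, rfl⟩ := Finset.mem_image.1 hc
      exact hbV y

lemma exists_closed_list {X : Type*} [MetricSpace X] [PolishSpace X] [MeasurableSpace X]
    [BorelSpace X] (μ : Measure X) [IsProbabilityMeasure μ] (𝒞 : Set (Set X))
    (h𝒞 : ∀ K V : Set X, IsCompact K → IsOpen V → K ⊆ V → ∃ C ∈ 𝒞, K ⊆ C ∧ C ⊆ V)
    (idx : X → ℕ) (hidx : Measurable idx) (ε : ℝ≥0∞) (hε : 0 < ε) (hεt : ε ≠ ⊤) :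
    ∃ L : List (Set X), (∀ C ∈ L, C ∈ 𝒞) ∧
      Pairwise (Function.onFun Disjoint fun l => L.getD l ∅) ∧
      μ {x | x ∉ L.getD (idx x) ∅} < ε := by
  classical
  have hε2 : 0 < ε / 2 := ENNReal.half_pos hε.ne'
  obtain ⟨r, hr⟩ : ∃ r : ℕ, μ {x | r ≤ idx x} < ε / 2 := by
    have ht := tendsto_measure_iInter_atTop (μ := μ) (s := fun r : ℕ => {x | r ≤ idx x})
      (fun r => (hidx measurableSet_Ici).nullMeasurableSet)
      (fun a b hab x hx => le_trans hab hx) ⟨0, measure_ne_top _ _⟩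
    have h0 : (⋂ r : ℕ, {x | r ≤ idx x}) = ∅ := by
      ext x
      simp only [Set.mem_iInter, Set.mem_ofPred_eq, Set.mem_empty_iff_false, iff_false, not_forall]
      exact ⟨idx x + 1, by omega⟩
    rw [h0, measure_empty] at ht
    exact (ht.eventually (gt_mem_nhds hε2)).exists
  have hε3 : ε / 2 / (r + 1) ≠ 0 := by
    have : ((r:ℝ≥0∞) + 1) ≠ ⊤ := by simp
    exact (ENNReal.div_pos hε2.ne' this).ne'
  have hK : ∀ i : Fin r, ∃ K ⊆ idx ⁻¹' {(i:ℕ)}, IsCompact K ∧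
      μ (idx ⁻¹' {(i:ℕ)} \ K) < ε / 2 / (r + 1) := fun i =>
    (hidx (measurableSet_singleton _)).exists_isCompact_sdiff_lt (measure_ne_top _ _) hε3
  choose K hKsub hKc hKμ using hK
  have hKd : Pairwise (Function.onFun Disjoint fun i => nhdsSet (K i)) := by
    intro i j hij
    refine SeparatedNhds.disjoint_nhdsSet (SeparatedNhds.of_isCompact_isCompact (hKc i) (hKc j) ?_)
    rw [Set.disjoint_left]
    intro x hx hy
    exact hij (Fin.ext ((hKsub i hx).symm.trans (hKsub j hy)))
  obtain ⟨V, hV, hVd⟩ := hKd.exists_mem_filter_of_disjoint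
  have hC : ∀ i, ∃ C ∈ 𝒞, K i ⊆ C ∧ C ⊆ interior (V i) := fun i =>
    h𝒞 _ _ (hKc i) isOpen_interior (subset_interior_iff_mem_nhdsSet.2 (hV i))
  choose C hC𝒞 hKC hCV using hC
  have hget : ∀ l (h : l < r), (List.ofFn C).getD l ∅ = C ⟨l, h⟩ := by
    intro l h
    rw [List.getD_eq_getElem _ _ (by simpa using h)]; simp
  have hget' : ∀ l, r ≤ l → (List.ofFn C).getD l ∅ = ∅ := by
    intro l h
    rw [List.getD_eq_default _ _ (by simpa using h)]
  refine ⟨List.ofFn C, ?_, ?_, ?_⟩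
  · intro c hc
    obtain ⟨i, rfl⟩ := (List.mem_ofFn' _ _).1 hc
    exact hC𝒞 i
  · intro i j hij
    simp only [Function.onFun]
    rcases lt_or_ge i r with hi | hi
    · rcases lt_or_ge j r with hj | hj
      · rw [hget i hi, hget j hj]
        refine (hVd (i := ⟨i, hi⟩) (j := ⟨j, hj⟩) (by simpa using hij)).mono ?_ ?_ <;>
        exact (hCV _).trans interior_subset
      · rw [hget' j hj]; exact disjoint_bot_right
    · rw [hget' i hi]; exact disjoint_bot_left
  · have hsub : {x | x ∉ (List.ofFn C).getD (idx x) ∅} ⊆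
        {x | r ≤ idx x} ∪ ⋃ i : Fin r, (idx ⁻¹' {(i:ℕ)} \ K i) := by
      intro x hx
      rcases lt_or_ge (idx x) r with hi | hi
      · right
        refine Set.mem_iUnion.2 ⟨⟨idx x, hi⟩, rfl, fun h => hx ?_⟩
        rw [hget _ hi]
        exact hKC _ h
      · exact Or.inl hi
    calc μ {x | x ∉ (List.ofFn C).getD (idx x) ∅}
        ≤ μ {x | r ≤ idx x} + μ (⋃ i : Fin r, (idx ⁻¹' {(i:ℕ)} \ K i)) :=
          (measure_mono hsub).trans (measure_union_le _ _)
      _ ≤ μ {x | r ≤ idx x} + ε / 2 := by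
          gcongr
          calc _ ≤ ∑' i : Fin r, μ (idx ⁻¹' {(i:ℕ)} \ K i) := measure_iUnion_le _
            _ ≤ ∑' i : Fin r, ε / 2 / (r + 1) := ENNReal.tsum_le_tsum fun i => (hKμ i).le
            _ = r * (ε / 2 / (r + 1)) := by simp
            _ ≤ (r + 1) * (ε / 2 / (r + 1)) := by gcongr; exact le_self_add
            _ ≤ ε / 2 := ENNReal.mul_div_le
      _ < ε / 2 + ε / 2 := by
          exact ENNReal.add_lt_add_right (ENNReal.div_ne_top hεt (by simp)) hr
      _ = ε := ENNReal.add_halves ε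

/-- The open condition used to write zero entropy as a countable intersection. -/
def goodSet {X : Type*} [MeasurableSpace X] (f : X → X) (G : ℕ → Set X) (k : ℕ) :
    Set (ProbabilityMeasure X) :=
  {μ | ∃ n > k, ∃ S : Finset (Fin n → ℕ), Real.log S.card ≤ (n : ℝ) / (k + 1) ∧
    (μ : Measure X) (⋃ a ∈ S, dynRefine f (coverSet G) n a)ᶜ < ((k : ℝ≥0∞) + 1)⁻¹}

lemma isOpen_coverSet {X : Type*} [TopologicalSpace X] (L : List (Set X))
    (hL : ∀ C ∈ L, IsClosed C) (j : ℕ) : IsOpen (coverSet (fun l => L.getD l ∅) j) := by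
  have : coverSet (fun l => L.getD l ∅) j =
      (⋃ l ∈ (Finset.range L.length).filter (· ≠ j), L.getD l ∅)ᶜ := by
    ext x
    simp only [coverSet, Set.mem_ofPred_eq, Set.mem_compl_iff, Set.mem_iUnion, Finset.mem_filter,
      Finset.mem_range, not_exists]
    constructor
    · intro h l hl; exact h l hl.2
    · intro h l hl
      rcases lt_or_ge l L.length with h1 | h1
      · exact h l ⟨h1, hl⟩
      · rw [List.getD_eq_default _ _ h1]; simp
  rw [this, isOpen_compl_iff]
  refine (Finset.finite_toSet _).isClosed_biUnion fun l hl => ?_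
  have hl : l < L.length := by simp at hl; exact hl.1
  rw [List.getD_eq_getElem _ _ hl]
  exact hL _ (List.getElem_mem _)

lemma isOpen_dynUnion {X : Type*} [TopologicalSpace X] (f : X → X) (hf : Continuous f)
    (L : List (Set X)) (hL : ∀ C ∈ L, IsClosed C) {n : ℕ} (S : Finset (Fin n → ℕ)) :
    IsOpen (⋃ a ∈ S, dynRefine f (coverSet fun l => L.getD l ∅) n a) :=
  isOpen_biUnion fun _ _ => isOpen_iInter_of_finite fun i =>
    (isOpen_coverSet L hL _).preimage (hf.iterate i)

lemma isOpen_goodSet {X : Type*} [MetricSpace X] [MeasurableSpace X]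
    [BorelSpace X] (f : X → X) (hf : Continuous f) (L : List (Set X))
    (hL : ∀ C ∈ L, IsClosed C) (k : ℕ) : IsOpen (goodSet f (fun l => L.getD l ∅) k) := by
  rw [isOpen_iff_mem_nhds]
  rintro μ ⟨n, hn, S, hS, hμ⟩
  have hlim := ProbabilityMeasure.limsup_measure_closed_le_of_tendsto
    (tendsto_id (α := ProbabilityMeasure X) (x := nhds μ))
    (isOpen_dynUnion f hf L hL S).isClosed_compl
  have := eventually_lt_of_limsup_lt (hlim.trans_lt hμ)
  filter_upwards [this] with ν hν
  exact ⟨n, hn, S, hS, hν⟩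

lemma exists_idx {X : Type*} [MeasurableSpace X] (P : ℕ → Set X) (hP : IsMeasPartition P) :
    ∃ idx : X → ℕ, Measurable idx ∧ P = fun b => idx ⁻¹' {b} := by
  have h : ∀ x, ∃ b, x ∈ P b := fun x => by
    have : x ∈ ⋃ i, P i := by rw [hP.2.2]; trivial
    simpa using this
  choose idx hidx using h
  have hEq : P = fun b => idx ⁻¹' {b} := by
    funext b; ext x
    constructor
    · intro hx
      by_contra hne
      exact Set.disjoint_left.1 (hP.2.1 hne) (hidx x) hx
    · intro hx
      have hx : idx x = b := hx
      exact hx ▸ hidx x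
  refine ⟨idx, measurable_to_countable' fun b => ?_, hEq⟩
  have := hP.1 b
  rwa [hEq] at this

lemma mem_goodSet_of_zero {X : Type*} [MeasurableSpace X] (μ : ProbabilityMeasure X) (f : X → X)
    (hf : Measurable f) (L : List (Set X)) (hL : ∀ C ∈ L, MeasurableSet C)
    (hd : Pairwise (Function.onFun Disjoint fun l => L.getD l ∅))
    (h0 : metricEntropy (μ : Measure X) f = 0) (k : ℕ) :
    μ ∈ goodSet f (fun l => L.getD l ∅) k := by
  classical
  set G : ℕ → Set X := fun l => L.getD l ∅ with hGdef
  set r := L.length with hr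
  have hGr : ∀ l, r ≤ l → G l = ∅ := fun l hl => List.getD_eq_default _ _ hl
  have hGm : ∀ l, MeasurableSet (G l) := by
    intro l
    rcases lt_or_ge l r with h | h
    · simp only [hGdef]
      rw [List.getD_eq_getElem _ _ h]
      exact hL _ (List.getElem_mem _)
    · rw [hGr l h]; exact MeasurableSet.empty
  set P : ℕ → Set X := fun j => if j = r then (⋃ l, G l)ᶜ else G j with hPdef
  have hP : IsMeasPartition P := by
    refine ⟨fun j => ?_, fun i j hij => ?_, ?_⟩
    · simp only [hPdef]
      split_ifs
      · exact (MeasurableSet.iUnion hGm).compl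
      · exact hGm j
    · simp only [Function.onFun, hPdef]
      split_ifs with h1 h2 h2
      · exact absurd (h1.trans h2.symm) hij
      · exact Set.disjoint_left.2 fun x hx hy => hx (Set.mem_iUnion.2 ⟨_, hy⟩)
      · exact Set.disjoint_left.2 fun x hy hx => hx (Set.mem_iUnion.2 ⟨_, hy⟩)
      · exact hd hij
    · rw [Set.eq_univ_iff_forall]
      intro x
      by_cases hx : x ∈ ⋃ l, G l
      · obtain ⟨l, hl⟩ := Set.mem_iUnion.1 hx
        refine Set.mem_iUnion.2 ⟨l, ?_⟩
        have : l ≠ r := by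
          rintro rfl
          rw [hGr _ le_rfl] at hl
          exact hl
        simpa [hPdef, this] using hl
      · exact Set.mem_iUnion.2 ⟨r, by simpa [hPdef] using hx⟩
  have hPW : ∀ j, P j ⊆ coverSet G j := by
    intro j x hx l hl hxl
    simp only [hPdef] at hx
    split_ifs at hx with h
    · exact hx (Set.mem_iUnion.2 ⟨l, hxl⟩)
    · exact Set.disjoint_left.1 (hd hl) hxl hx
  have hH : partitionEntropy (μ : Measure X) P < ⊤ := by
    unfold partitionEntropy
    rw [tsum_eq_sum (s := Finset.range (r + 1))]
    · exact ENNReal.sum_lt_top.2 fun i _ => ENNReal.ofReal_lt_top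
    · intro b hb
      have hb : r + 1 ≤ b := by simpa using hb
      have : P b = ∅ := by
        simp only [hPdef]
        rw [if_neg (by omega), hGr b (by omega)]
      simp [this]
  have hlim : liminf (fun n : ℕ => partitionEntropy (μ : Measure X) (dynRefine f P n) /
      (n : ℝ≥0∞)) atTop = 0 := by
    refine le_antisymm ?_ bot_le
    rw [← h0]
    exact le_iSup₂ (f := fun (P : ℕ → Set X)
      (_ : IsMeasPartition P ∧ partitionEntropy (μ : Measure X) P < ⊤) =>
      liminf (fun n : ℕ => partitionEntropy (μ : Measure X) (dynRefine f P n) /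
      (n : ℝ≥0∞)) atTop) P ⟨hP, hH⟩
  set d : ℝ≥0∞ := ((k : ℝ≥0∞) + 1)⁻¹ with hddef
  have hk : (0:ℝ) < (k:ℝ) + 1 := by positivity
  have hd' : d = ENNReal.ofReal (1 / ((k:ℝ) + 1)) := by
    rw [one_div, ENNReal.ofReal_inv_of_pos hk, ENNReal.ofReal_add (by positivity) zero_le_one]
    simp [hddef]
  have hd0 : d ≠ 0 := by simp [hddef]
  have hdt : d ≠ ⊤ := by simp [hddef]
  have hfreq := frequently_lt_of_liminf_lt (b := d * d)
    (by isBoundedDefault) (hlim.trans_lt (pos_iff_ne_zero.2 (mul_ne_zero hd0 hd0)))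
  obtain ⟨n, hn, hnk⟩ := (hfreq.and_eventually (eventually_gt_atTop k)).exists
  have hn0 : (n : ℝ≥0∞) ≠ 0 := by
    have : n ≠ 0 := by omega
    exact_mod_cast this
  have hHn : partitionEntropy (μ : Measure X) (dynRefine f P n) < d * d * n := by
    rwa [ENNReal.div_lt_iff (Or.inl hn0) (Or.inl (by simp))] at hn
  obtain ⟨idx, hidx, hPidx⟩ := exists_idx P hP
  set B : X → (Fin n → ℕ) := fun x i => idx (f^[i] x) with hB
  have hBm : Measurable B := measurable_pi_lambda _ fun i => hidx.comp (hf.iterate i)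
  set A : (Fin n → ℕ) → Set X := dynRefine f P n with hA
  have hAB : ∀ b, A b = B ⁻¹' {b} := by
    intro b; ext x; rw [hA, hPidx]; simp [dynRefine, hB, funext_iff]
  have hAm : ∀ b, MeasurableSet (A b) := fun b => by
    rw [hAB]; exact hBm (measurableSet_singleton b)
  have hAd : Pairwise (Function.onFun Disjoint A) := by
    intro a b hab
    simp only [Function.onFun, hAB]
    exact Set.disjoint_left.2 fun x hx hy => hab (Eq.trans (Eq.symm hx) hy)
  set t : ℝ := (n : ℝ) / (k + 1) with ht
  have hfin : Set.Finite {a | ENNReal.ofReal (Real.exp (-t)) ≤ (μ : Measure X) (A a)} :=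
    Measure.finite_const_le_meas_of_disjoint_iUnion _
      (ENNReal.ofReal_pos.2 (Real.exp_pos _)) hAm hAd (measure_ne_top _ _)
  set S := hfin.toFinset with hS
  have hmemS : ∀ a, a ∈ S ↔ ENNReal.ofReal (Real.exp (-t)) ≤ (μ : Measure X) (A a) := by
    intro a; simp [hS]
  have htn : ENNReal.ofReal t = d * n := by
    rw [hd', ← ENNReal.ofReal_natCast, ← ENNReal.ofReal_mul (by positivity)]
    congr 1
    rw [ht]; ring
  refine ⟨n, hnk, S, ?_, ?_⟩
  · rcases Nat.eq_zero_or_pos S.card with h | h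
    · rw [h]; simp; positivity
    · rw [Real.log_le_iff_le_exp (by exact_mod_cast h)]
      have h1 : ∑ a ∈ S, ENNReal.ofReal (Real.exp (-t)) ≤ 1 := by
        calc _ ≤ ∑ a ∈ S, (μ : Measure X) (A a) :=
              Finset.sum_le_sum fun a ha => (hmemS a).1 ha
          _ ≤ ∑' a, (μ : Measure X) (A a) := ENNReal.sum_le_tsum _
          _ ≤ (μ : Measure X) Set.univ := tsum_measure_le_measure_univ
              (fun a => (hAm a).nullMeasurableSet) fun a b hab => (hAd hab).aedisjoint
          _ = 1 := measure_univ
      rw [Finset.sum_const, nsmul_eq_mul, ← ENNReal.ofReal_natCast,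
        ← ENNReal.ofReal_mul (by positivity), ENNReal.ofReal_le_one, Real.exp_neg,
        mul_inv_le_iff₀ (Real.exp_pos _), one_mul] at h1
      exact h1
  · have hsub : (⋃ a ∈ S, dynRefine f (coverSet G) n a)ᶜ ⊆ ⋃ a, (if a ∈ S then ∅ else A a) := by
      intro x hx
      refine Set.mem_iUnion.2 ⟨B x, ?_⟩
      have hxA : x ∈ A (B x) := by rw [hAB]; rfl
      split_ifs with hm
      · refine hx (Set.mem_biUnion hm ?_)
        simp only [hA, dynRefine, Set.mem_iInter] at hxA ⊢
        exact fun i => hPW _ (hxA i)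
      · exact hxA
    have hbound : ENNReal.ofReal t * (μ : Measure X) (⋃ a ∈ S, dynRefine f (coverSet G) n a)ᶜ ≤
        partitionEntropy (μ : Measure X) A := by
      calc _ ≤ ENNReal.ofReal t * ∑' a, (μ : Measure X) (if a ∈ S then ∅ else A a) := by
            gcongr
            exact (measure_mono hsub).trans (measure_iUnion_le _)
        _ = ∑' a, ENNReal.ofReal t * (μ : Measure X) (if a ∈ S then ∅ else A a) :=
            ENNReal.tsum_mul_left.symm
        _ ≤ _ := by
            refine ENNReal.tsum_le_tsum fun a => ?_
            split_ifs with hm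
            · simp
            · rw [hmemS, not_le, ENNReal.lt_ofReal_iff_toReal_lt (measure_ne_top _ _)] at hm
              rw [← ENNReal.ofReal_toReal (measure_ne_top (μ : Measure X) (A a)),
                ← ENNReal.ofReal_mul' ENNReal.toReal_nonneg,
                ENNReal.toReal_ofReal ENNReal.toReal_nonneg]
              apply ENNReal.ofReal_le_ofReal
              have hm0 : 0 ≤ ((μ : Measure X) (A a)).toReal := ENNReal.toReal_nonneg
              generalize ((μ : Measure X) (A a)).toReal = m at *
              rcases hm0.eq_or_lt with h | h
              · simp [← h]
              · have := Real.log_lt_log h hm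
                rw [Real.log_exp] at this
                rw [Real.negMulLog]
                nlinarith
    rw [htn] at hbound
    by_contra hcon
    rw [not_lt] at hcon
    have : d * n * d ≤ d * n * (μ : Measure X) (⋃ a ∈ S, dynRefine f (coverSet G) n a)ᶜ := by
      gcongr
    have h2 := (this.trans hbound).trans_lt hHn
    rw [mul_right_comm] at h2
    exact lt_irrefl _ h2

lemma zero_of_mem_goodSet {X : Type*} [MetricSpace X] [PolishSpace X] [MeasurableSpace X]
    [BorelSpace X] (μ : ProbabilityMeasure X) (f : X → X)
    (hf : MeasurePreserving f (μ : Measure X) (μ : Measure X)) (hfc : Continuous f)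
    (𝒞 : Set (Set X)) (h𝒞c : ∀ C ∈ 𝒞, IsClosed C)
    (h𝒞 : ∀ K V : Set X, IsCompact K → IsOpen V → K ⊆ V → ∃ C ∈ 𝒞, K ⊆ C ∧ C ⊆ V)
    (hgood : ∀ L : List (Set X), (∀ C ∈ L, C ∈ 𝒞) →
      Pairwise (Function.onFun Disjoint fun l => L.getD l ∅) →
      ∀ k, μ ∈ goodSet f (fun l => L.getD l ∅) k) :
    metricEntropy (μ : Measure X) f = 0 := by
  refine le_antisymm (iSup₂_le fun P hPH => ?_) bot_le
  obtain ⟨hP, hH⟩ := hPH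
  obtain ⟨p, hp, hp1, hps, hpw⟩ := exists_weight (μ : Measure X) P hP hH
  obtain ⟨idx, hidx, rfl⟩ := exists_idx P hP
  refine le_of_forall_gt_imp_ge_of_dense fun η hη => ?_
  rcases eq_or_ne η ⊤ with rfl | hηt
  · exact le_top
  refine liminf_le_of_frequently_le' (frequently_atTop.2 fun N => ?_)
  set e := η / 4 with he
  have he0 : e ≠ 0 := (ENNReal.div_pos hη.ne' (by simp)).ne'
  have het : e ≠ ⊤ := ENNReal.div_ne_top hηt (by simp)
  have heη : e + (e + e + e) = η := by
    have : e + (e + e + e) = e * 4 := by ring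
    rw [this, he, ENNReal.div_mul_cancel] <;> simp
  have htpos : 0 < e.toReal := ENNReal.toReal_pos he0 het
  set θ : ℝ := 1 - Real.exp (-e.toReal) with hθdef
  have hθ1 : θ < 1 := by have := Real.exp_pos (-e.toReal); linarith
  have hθ0 : 0 < θ := by
    have : Real.exp (-e.toReal) < 1 := by simpa using htpos
    linarith
  have hc : ENNReal.ofReal (-Real.log (1 - θ)) = e := by
    rw [hθdef]; simp [ENNReal.ofReal_toReal het]
  set C := ENNReal.ofReal (-Real.log θ) with hC
  set w : ℕ → ℝ≥0∞ := fun b => ENNReal.ofReal (-Real.log (p b)) with hw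
  have hΦ : ∫⁻ x, (C + w (idx x)) ∂(μ : Measure X) ≠ ⊤ := by
    rw [lintegral_add_left measurable_const, lintegral_const, measure_univ,
      ← lintegral_map (f := w) (g := idx) (measurable_of_countable _) hidx, lintegral_countable']
    have : ∀ b, (μ : Measure X).map idx {b} = (μ : Measure X) (idx ⁻¹' {b}) := fun b =>
      Measure.map_apply hidx (measurableSet_singleton b)
    simp_rw [this]
    exact ENNReal.add_ne_top.2 ⟨by simp [hC], hpw.ne⟩
  obtain ⟨δ, hδ, hδs⟩ := exists_pos_setLIntegral_lt_of_measure_lt hΦ he0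
  obtain ⟨L, hL𝒞, hLd, hLμ⟩ := exists_closed_list (μ : Measure X) 𝒞 h𝒞 idx hidx (min δ 1)
    (lt_min hδ one_pos) (ne_top_of_le_ne_top ENNReal.one_ne_top (min_le_right _ _))
  have hint := hδs _ (hLμ.trans_le (min_le_left _ _))
  have hLc : ∀ C ∈ L, IsClosed C := fun C hC => h𝒞c C (hL𝒞 C hC)
  set G : ℕ → Set X := fun l => L.getD l ∅ with hGdef
  have hGr : ∀ l, L.length ≤ l → G l = ∅ := fun l hl => List.getD_eq_default _ _ hl
  have hGm : ∀ l, MeasurableSet (G l) := by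
    intro l
    rcases lt_or_ge l L.length with h | h
    · simp only [hGdef]
      rw [List.getD_eq_getElem _ _ h]
      exact (hLc _ (List.getElem_mem _)).measurableSet
    · rw [hGr l h]; exact MeasurableSet.empty
  set M : ℝ≥0∞ := ∑ b ∈ Finset.range L.length, w b with hMdef
  have hMt : M ≠ ⊤ := (ENNReal.sum_lt_top.2 fun b _ => ENNReal.ofReal_lt_top).ne
  have hM : ∀ x, x ∈ G (idx x) → w (idx x) ≤ M := by
    intro x hx
    have hlt : idx x < L.length := by
      by_contra hcon
      rw [hGr _ (not_lt.1 hcon)] at hx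
      exact hx
    exact Finset.single_le_sum (f := w) (fun _ _ => zero_le) (Finset.mem_range.2 hlt)
  obtain ⟨k₀, hk₀⟩ := ENNReal.exists_nat_gt (r := (1 + (C + M)) / e)
    (ENNReal.div_ne_top (by simp [hC, hMt]) he0)
  set k := max k₀ N with hk
  have hk1 : (1 + (C + M)) * ((k : ℝ≥0∞) + 1)⁻¹ ≤ e := by
    rw [← div_eq_mul_inv]
    apply ENNReal.div_le_of_le_mul
    rw [mul_comm]
    have h1 : (1 + (C + M)) ≤ k₀ * e := (ENNReal.div_le_iff he0 het).1 hk₀.le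
    refine h1.trans ?_
    gcongr
    have : (k₀ : ℝ≥0∞) ≤ k := by exact_mod_cast le_max_left _ _
    exact this.trans le_self_add
  have hk2 : ((k : ℝ≥0∞) + 1)⁻¹ ≤ e := by
    refine le_trans ?_ hk1
    rw [add_mul, one_mul]; exact le_self_add
  have hk3 : (C + M) * ((k : ℝ≥0∞) + 1)⁻¹ ≤ e := by
    refine le_trans ?_ hk1
    exact mul_le_mul_left (le_add_self : C + M ≤ 1 + (C + M)) _
  obtain ⟨n, hnk, S, hSlog, hSμ⟩ := hgood L hL𝒞 hLd k
  refine ⟨n, (le_max_right k₀ N).trans hnk.le, ?_⟩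
  have hSne : S.Nonempty := by
    by_contra hcon
    rw [Finset.not_nonempty_iff_eq_empty] at hcon
    subst hcon
    simp at hSμ
    exact absurd hSμ (not_lt.2 le_add_self)
  have hb := entropy_bound (μ : Measure X) f hf idx hidx p hp hps θ hθ0 hθ1 G hGm M hM n S hSne
    _ (isOpen_dynUnion f hfc L hLc S).measurableSet subset_rfl
  apply ENNReal.div_le_of_le_mul
  refine hb.trans ?_
  rw [hc]
  have hlog : ENNReal.ofReal (Real.log S.card) ≤ n * e := by
    refine (ENNReal.ofReal_le_ofReal hSlog).trans ?_
    rw [ENNReal.ofReal_div_of_pos (by positivity), ENNReal.ofReal_add (by positivity) zero_le_one]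
    simp only [ENNReal.ofReal_natCast, ENNReal.ofReal_one]
    rw [div_eq_mul_inv]
    gcongr
  calc _ ≤ n * e + n * (e + e + e) := by
        gcongr
        refine le_trans ?_ hk3
        gcongr
    _ = η * n := by rw [← mul_add, heη, mul_comm]

lemma isGδ_zero_entropy {X : Type*} [MetricSpace X] [PolishSpace X] [MeasurableSpace X]
    [BorelSpace X] (f : X → X) (hf : Continuous f) :
    ∃ E : Set (ProbabilityMeasure X), IsGδ E ∧ ∀ μ : ProbabilityMeasure X,
      Measure.map f (μ : Measure X) = (μ : Measure X) →
      (μ ∈ E ↔ metricEntropy (μ : Measure X) f = 0) := by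
  obtain ⟨𝒞, hcount, hcl, h𝒞⟩ := exists_closed_family X
  have hcount' : {L : List (Set X) | ∀ C ∈ L, C ∈ 𝒞}.Countable := by
    have := hcount.to_subtype
    have h : {L : List (Set X) | ∀ C ∈ L, C ∈ 𝒞} ⊆
        Set.range (fun L : List 𝒞 => L.map Subtype.val) := by
      intro L hL
      exact ⟨L.attach.map fun C => ⟨C.1, hL C.1 C.2⟩, by simp⟩
    exact (Set.countable_range _).mono h
  refine ⟨⋂ L ∈ {L : List (Set X) | ∀ C ∈ L, C ∈ 𝒞},
    ⋂ (_ : Pairwise (Function.onFun Disjoint fun l => L.getD l ∅)),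
      ⋂ k : ℕ, goodSet f (fun l => L.getD l ∅) k, ?_, ?_⟩
  · refine IsGδ.biInter hcount' fun L hL => IsGδ.iInter fun _ => IsGδ.iInter_of_isOpen fun k => ?_
    exact isOpen_goodSet f hf L (fun C hC => hcl C (hL C hC)) k
  · intro μ hμ
    simp only [Set.mem_iInter]
    constructor
    · intro h
      exact zero_of_mem_goodSet μ f ⟨hf.measurable, hμ⟩ hf 𝒞 hcl h𝒞
        fun L hL hd k => h L hL hd k
    · intro h L hL hd k
      exact mem_goodSet_of_zero μ f hf.measurable L
        (fun C hC => (hcl C (hL C hC)).measurableSet) hd h k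

theorem stmt13 {X : Type*} [MetricSpace X] [PolishSpace X] [MeasurableSpace X] [BorelSpace X]
    (f : X → X) (hf : UniformContinuous f) :
    IsGδ {μ : {ν : ProbabilityMeasure X // Ergodic f (ν : Measure X)} |
        metricEntropy ((μ : ProbabilityMeasure X) : Measure X) f = 0} ∧
      (IsGδ {ν : {ρ : ProbabilityMeasure X //
            Measure.map f (ρ : Measure X) = (ρ : Measure X)} |
          Ergodic f ((ν : ProbabilityMeasure X) : Measure X)} →
        Dense {ν : {ρ : ProbabilityMeasure X //
            Measure.map f (ρ : Measure X) = (ρ : Measure X)} |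
          metricEntropy ((ν : ProbabilityMeasure X) : Measure X) f = 0} →
        ∃ S ⊆ {ν : {ρ : ProbabilityMeasure X //
            Measure.map f (ρ : Measure X) = (ρ : Measure X)} |
          metricEntropy ((ν : ProbabilityMeasure X) : Measure X) f = 0},
          IsGδ S ∧ Dense S) := by
  obtain ⟨E, hE, hEiff⟩ := isGδ_zero_entropy f hf.continuous
  refine ⟨?_, fun _ hdense => ⟨_, subset_rfl, ?_, hdense⟩⟩
  · convert hE.preimage (continuous_subtype_val
      (p := fun ν : ProbabilityMeasure X => Ergodic f (ν : Measure X))) using 1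
    ext μ
    exact (hEiff μ.1 μ.2.toMeasurePreserving.map_eq).symm
  · convert hE.preimage (continuous_subtype_val
      (p := fun ν : ProbabilityMeasure X => Measure.map f (ν : Measure X) = (ν : Measure X)))
      using 1
    ext μ
    exact (hEiff μ.1 μ.2).symm
end
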